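/- Let α be a cone angle on ℝ^d and let Z ⊂ ℝ^d be a full-dimensional zonotope with lattice of flats L(Z). Then for every nonempty S ⊆ {0, 1, …, d−1}, with r = min(S): α̌_S(Z) = W_S(L(Z)) and α̂_S(Z) = (−1)^{d−r} w_{d−S}(L(Z)^op), where d − S = {d − s : s ∈ S}. -/

import Mathlib

open scoped BigOperators InnerProductSpace Pointwise

noncomputable section

/-- Euclidean space `ℝ^d`. -/
abbrev Euc (d : ℕ) : Type := EuclideanSpace ℝ (Fin d)

namespace GramAngles

variable {d : ℕ}

/-- The conical (positive) hull of a set. -/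
def posHull (S : Set (Euc d)) : Set (Euc d) :=
  {u | ∃ c : ℝ, ∃ p ∈ S, 0 ≤ c ∧ u = c • p}

/-- The dimension of a set: the rank of the linear subspace parallel to its affine hull. -/
def sdim (S : Set (Euc d)) : ℕ := Module.finrank ℝ (vectorSpan ℝ S)

/-- A polyhedral cone with apex at the origin: a finitely generated convex cone. -/
def IsPolyhedralCone (C : Set (Euc d)) : Prop :=
  ∃ (n : ℕ) (v : Fin n → Euc d),
    C = {x | ∃ c : Fin n → ℝ, (∀ i, 0 ≤ c i) ∧ x = ∑ i, c i • v i}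

/-- A cone angle on `ℝ^d`: a simple, normalized valuation on polyhedral cones. -/
structure ConeAngle (d : ℕ) where
  toFun : Set (Euc d) → ℝ
  zero' : toFun {0} = 0
  union' : ∀ C C' : Set (Euc d), IsPolyhedralCone C → IsPolyhedralCone C' →
    IsPolyhedralCone (C ∪ C') → IsPolyhedralCone (C ∩ C') →
    toFun (C ∪ C') = toFun C + toFun C' - toFun (C ∩ C')
  simple' : ∀ C : Set (Euc d), IsPolyhedralCone C → sdim C < d → toFun C = 0
  norm' : toFun Set.univ = 1

/-- A (convex) polytope: the convex hull of a nonempty finite point set. -/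
def IsPolytope (P : Set (Euc d)) : Prop :=
  ∃ s : Finset (Euc d), s.Nonempty ∧ P = convexHull ℝ (s : Set (Euc d))

/-- Faces of a polytope are its exposed subsets (including `∅` and `P` itself). -/
def IsFace (P F : Set (Euc d)) : Prop := IsExposed ℝ P F

open Classical in
/-- A chosen point in the relative interior of `F`. -/
def relPt (F : Set (Euc d)) : Euc d :=
  if h : (intrinsicInterior ℝ F).Nonempty then h.some else 0

/-- The tangent (inner) cone `T_F G = cone(-q + G) + L(G)^⊥`, `q ∈ relint F`. -/
def innerCone (F G : Set (Euc d)) : Set (Euc d) :=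
  posHull ((fun x => x - relPt F) '' G) + (((vectorSpan ℝ G)ᗮ : Submodule ℝ (Euc d)) : Set (Euc d))

/-- The normal cone `N_F G` of `G` at a face `F`. -/
def normalCone (F G : Set (Euc d)) : Set (Euc d) :=
  {c | ∀ x ∈ F, ∀ y ∈ G, ⟪c, y⟫_ℝ ≤ ⟪c, x⟫_ℝ}

/-- The outer cone `O_F G = N_F G + L(F)`. -/
def outerCone (F G : Set (Euc d)) : Set (Euc d) :=
  normalCone F G + ((vectorSpan ℝ F : Submodule ℝ (Euc d)) : Set (Euc d))

/-- Interior angle of `G` at its face `F`, measured by the cone angle `α`. -/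
def intAngle (α : ConeAngle d) (F G : Set (Euc d)) : ℝ := α.toFun (innerCone F G)

/-- Exterior angle of `G` at its face `F`, measured by the cone angle `α`. -/
def extAngle (α : ConeAngle d) (F G : Set (Euc d)) : ℝ := α.toFun (outerCone F G)

/-- `α̂_i(P)`: sum of interior angles over all `i`-dimensional (nonempty) faces of `P`. -/
def intAngleSum (α : ConeAngle d) (P : Set (Euc d)) (i : ℕ) : ℝ :=
  ∑ᶠ F ∈ {F : Set (Euc d) | IsFace P F ∧ F.Nonempty ∧ sdim F = i}, intAngle α F P

/-- `α̌_i(P)`: sum of exterior angles over all `i`-dimensional (nonempty) faces of `P`. -/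
def extAngleSum (α : ConeAngle d) (P : Set (Euc d)) (i : ℕ) : ℝ :=
  ∑ᶠ F ∈ {F : Set (Euc d) | IsFace P F ∧ F.Nonempty ∧ sdim F = i}, extAngle α F P

/-- A zonotope: a translate of a Minkowski sum of finitely many segments. -/
def IsZonotope (Z : Set (Euc d)) : Prop :=
  ∃ (t : Euc d) (n : ℕ) (z : Fin n → Euc d),
    Z = {x | ∃ l : Fin n → ℝ, (∀ i, |l i| ≤ 1) ∧ x = t + ∑ i, l i • z i}

/-- The face of `P` on which the linear functional `⟪c, ·⟫` is maximized. -/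
def maxFace (P : Set (Euc d)) (c : Euc d) : Set (Euc d) :=
  {x ∈ P | ∀ y ∈ P, ⟪c, y⟫_ℝ ≤ ⟪c, x⟫_ℝ}

/-- A belt polytope: a polytope whose normal fan is the fan induced by a central
hyperplane arrangement (two functionals maximize the same face iff they have the
same sign pattern with respect to the arrangement). -/
def IsBeltPolytope (P : Set (Euc d)) : Prop :=
  IsPolytope P ∧ ∃ (k : ℕ) (z : Fin k → Euc d), (∀ i, z i ≠ 0) ∧
    ∀ c c' : Euc d,
      ((∀ i, Real.sign ⟪z i, c⟫_ℝ = Real.sign ⟪z i, c'⟫_ℝ) ↔ maxFace P c = maxFace P c')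

/-- The set of flats of a polytope: linear subspaces parallel to nonempty faces,
ordered by inclusion (as a subtype of `Submodule ℝ (Euc d)`). -/
def Flats (P : Set (Euc d)) : Set (Submodule ℝ (Euc d)) :=
  {L | ∃ F : Set (Euc d), IsFace P F ∧ F.Nonempty ∧ L = vectorSpan ℝ F}

/-- Strictly increasing chains from `a` to `c` in a poset, encoded as lists. -/
def chainsFromTo {β : Type*} [Preorder β] (a c : β) : Set (List β) :=
  {l | l.Chain' (· < ·) ∧ l.head? = some a ∧ l.getLast? = some c}

/-- The Möbius function of a poset, via Philip Hall's chain formula. -/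
def mob {β : Type*} [Preorder β] (a c : β) : ℝ :=
  ∑ᶠ l ∈ chainsFromTo a c, (-1 : ℝ) ^ (l.length + 1)

/-- Whitney numbers of the first kind of a ranked poset with minimum `bot`. -/
def whitney1 {β : Type*} [Preorder β] (rk : β → ℕ) (bot : β) (i : ℕ) : ℝ :=
  ∑ᶠ a ∈ {a : β | rk a = i}, mob bot a

/-- Flag-Whitney numbers of the second kind: the number of chains with rank set `S`. -/
def flagW2 {β : Type*} [Preorder β] (rk : β → ℕ) (S : Finset ℕ) : ℕ :=
  Nat.card {l : List β // l.Chain' (· < ·) ∧ l.map rk = S.sort (· ≤ ·)}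

/-- Flag-Whitney numbers of the first kind:
`w_S = Σ μ(0̂,c₁) μ(c₁,c₂) ⋯ μ(c_{k-1},c_k)` over chains with rank set `S`. -/
def flagW1 {β : Type*} [Preorder β] (rk : β → ℕ) (bot : β) (S : Finset ℕ) : ℝ :=
  ∑ᶠ l ∈ {l : List β | l.Chain' (· < ·) ∧ l.map rk = S.sort (· ≤ ·)},
    (List.zipWith mob (bot :: l) l).prod

/-- Chains of nonempty faces of `P` whose dimensions are exactly the set `S`. -/
def faceChains (P : Set (Euc d)) (S : Finset ℕ) : Set (List (Set (Euc d))) :=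
  {l | (∀ F ∈ l, IsFace P F ∧ F.Nonempty) ∧ l.Chain' (· ⊂ ·) ∧ l.map sdim = S.sort (· ≤ ·)}

/-- The interior flag-angle `α̂_S(P) = Σ α̂(F₁,F₂) α̂(F₂,F₃) ⋯ α̂(F_k,P)`. -/
def intFlag (α : ConeAngle d) (P : Set (Euc d)) (S : Finset ℕ) : ℝ :=
  ∑ᶠ l ∈ faceChains P S, (List.zipWith (intAngle α) l (l.drop 1 ++ [P])).prod

/-- The exterior flag-angle `α̌_S(P) = Σ α̌(F₁,F₂) α̌(F₂,F₃) ⋯ α̌(F_k,P)`. -/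
def extFlag (α : ConeAngle d) (P : Set (Euc d)) (S : Finset ℕ) : ℝ :=
  ∑ᶠ l ∈ faceChains P S, (List.zipWith (extAngle α) l (l.drop 1 ++ [P])).prod

/-- Membership in the incidence algebra: vanishing off the order relation. -/
def memIA {β : Type*} [Preorder β] (h : β → β → ℝ) : Prop :=
  ∀ a c, ¬ a ≤ c → h a c = 0

/-- Convolution product of the incidence algebra. -/
def conv {β : Type*} [Preorder β] (g h : β → β → ℝ) (a c : β) : ℝ :=
  ∑ᶠ (b : β) (_ : a ≤ b ∧ b ≤ c), g a b * h b c

/-- The product `∗_k`, summing over middle elements of rank `k`. -/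
def convk {β : Type*} (rk : β → ℕ) (k : ℕ) (g h : β → β → ℝ) (a c : β) : ℝ :=
  ∑ᶠ (b : β) (_ : rk b = k), g a b * h b c

/-- The pushforward `φ_* h (q,q') = |φ⁻¹(q')|⁻¹ Σ_{p ∈ φ⁻¹(q), p' ∈ φ⁻¹(q')} h(p,p')`. -/
def pushf {β γ : Type*} (φ : β → γ) (h : β → β → ℝ) (q q' : γ) : ℝ :=
  (Nat.card {p : β // φ p = q'} : ℝ)⁻¹ *
    ∑ᶠ (p : β) (_ : φ p = q) (p' : β) (_ : φ p' = q'), h p p'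

/-- The subspace `I_φ(𝒫)`: elements whose fiberwise column sums are independent of
the representative of the target fiber. -/
def memIphi {β γ : Type*} [Preorder β] (φ : β → γ) (h : β → β → ℝ) : Prop :=
  memIA h ∧ ∀ (q : γ) (p₁ p₂ : β), φ p₁ = φ p₂ →
    (∑ᶠ (p : β) (_ : φ p = q), h p p₁) = (∑ᶠ (p : β) (_ : φ p = q), h p p₂)

open Classical in
/-- The pullback `φ^* g (p,p') = g(φ p, φ p')` for `p ≤ p'`, else `0`. -/
def pullb {β γ : Type*} [Preorder β] (φ : β → γ) (g : γ → γ → ℝ) (p p' : β) : ℝ :=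
  if p ≤ p' then g (φ p) (φ p') else 0

open Classical in
/-- The identity `δ` of the incidence algebra. -/
def deltaIA {β : Type*} (a c : β) : ℝ := if a = c then 1 else 0

end GramAngles

namespace GramAngles
variable {d : ℕ}

/-- Fourier–Motzkin elimination. -/
lemma fourier_motzkin (s : Finset (Euc d)) (v : Euc d) :
    ∃ s' : Finset (Euc d), ∀ x : Euc d,
      (∃ t : ℝ, 0 ≤ t ∧ ∀ h ∈ s, 0 ≤ ⟪h, x - t • v⟫_ℝ) ↔ ∀ h ∈ s', 0 ≤ ⟪h, x⟫_ℝ := by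
  classical
  refine ⟨s.filter (fun h => 0 ≤ ⟪h, v⟫_ℝ) ∪
    ((s.filter (fun h => 0 < ⟪h, v⟫_ℝ)) ×ˢ (s.filter (fun h => ⟪h, v⟫_ℝ < 0))).image
      (fun pq => ⟪pq.1, v⟫_ℝ • pq.2 - ⟪pq.2, v⟫_ℝ • pq.1), fun x => ⟨?_, ?_⟩⟩
  · rintro ⟨t, ht, H⟩ h hh
    simp only [inner_sub_right, inner_smul_right] at H
    rw [Finset.mem_union] at hh
    rcases hh with hh | hh
    · rw [Finset.mem_filter] at hh
      have := H h hh.1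
      nlinarith [mul_nonneg ht hh.2]
    · rw [Finset.mem_image] at hh
      obtain ⟨⟨p, q⟩, hpq, rfl⟩ := hh
      simp only [Finset.mem_product, Finset.mem_filter] at hpq
      obtain ⟨⟨hp, hp'⟩, hq, hq'⟩ := hpq
      have h1 := H p hp
      have h2 := H q hq
      simp only [inner_sub_left, real_inner_smul_left]
      nlinarith [mul_nonneg hp'.le h2, mul_nonneg (neg_nonneg.2 hq'.le) h1]
  · intro H
    simp only [inner_sub_right, inner_smul_right]
    have H0 : ∀ h ∈ s, 0 ≤ ⟪h, v⟫_ℝ → 0 ≤ ⟪h, x⟫_ℝ := fun h hh hv =>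
      H h (Finset.mem_union_left _ (Finset.mem_filter.2 ⟨hh, hv⟩))
    have H1 : ∀ p ∈ s, 0 < ⟪p, v⟫_ℝ → ∀ q ∈ s, ⟪q, v⟫_ℝ < 0 →
        ⟪q, x⟫_ℝ / ⟪q, v⟫_ℝ ≤ ⟪p, x⟫_ℝ / ⟪p, v⟫_ℝ := by
      intro p hp hpv q hq hqv
      have := H _ (Finset.mem_union_right _ (Finset.mem_image.2 ⟨(p, q), by
        simp [hp, hq, hpv, hqv], rfl⟩))
      simp only [inner_sub_left, real_inner_smul_left] at this
      rw [← neg_div_neg_eq, div_le_div_iff₀ (by linarith) hpv]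
      nlinarith
    -- choose t = max of lower bounds
    let lows : Finset ℝ := insert 0 ((s.filter (fun h => ⟪h, v⟫_ℝ < 0)).image
      (fun q => ⟪q, x⟫_ℝ / ⟪q, v⟫_ℝ))
    have hne : lows.Nonempty := Finset.insert_nonempty _ _
    refine ⟨lows.max' hne, Finset.le_max' _ _ (Finset.mem_insert_self _ _), fun h hh => ?_⟩
    rcases lt_trichotomy ⟪h, v⟫_ℝ 0 with hv | hv | hv
    · have : ⟪h, x⟫_ℝ / ⟪h, v⟫_ℝ ≤ lows.max' hne :=
        Finset.le_max' lows _ (Finset.mem_insert_of_mem (Finset.mem_image_of_mem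
          (fun q => ⟪q, x⟫_ℝ / ⟪q, v⟫_ℝ) (Finset.mem_filter.2 ⟨hh, hv⟩)))
      rw [div_le_iff_of_neg hv] at this
      linarith
    · rw [hv]; have := H0 h hh hv.ge; linarith
    · have : lows.max' hne ≤ ⟪h, x⟫_ℝ / ⟪h, v⟫_ℝ := by
        apply Finset.max'_le
        intro y hy
        rcases Finset.mem_insert.1 hy with rfl | hy
        · exact div_nonneg (H0 h hh hv.le) hv.le
        · obtain ⟨q, hq, rfl⟩ := Finset.mem_image.1 hy
          rw [Finset.mem_filter] at hq
          exact H1 h hh hv q hq.1 hq.2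
      rw [le_div_iff₀ hv] at this
      linarith

/-- Finitely generated cones are finite intersections of half-spaces. -/
lemma weyl (t : Finset (Euc d)) : ∃ s : Finset (Euc d), ∀ x : Euc d,
    x ∈ PointedCone.hull ℝ (t : Set (Euc d)) ↔ ∀ h ∈ s, 0 ≤ ⟪h, x⟫_ℝ := by
  classical
  induction t using Finset.induction_on with
  | empty =>
    refine ⟨Finset.univ.image (fun i : Fin d => EuclideanSpace.single i (1 : ℝ)) ∪
      Finset.univ.image (fun i : Fin d => - EuclideanSpace.single i (1 : ℝ)), fun x => ?_⟩
    constructor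
    · intro hx
      have : x = 0 := by simpa using hx
      simp [this]
    · intro H
      have : x = 0 := by
        ext i
        have h1 := H (EuclideanSpace.single i (1 : ℝ)) (by simp)
        have h2 := H (- EuclideanSpace.single i (1 : ℝ)) (by simp)
        simp [EuclideanSpace.inner_single_left] at h1 h2
        simpa using le_antisymm h2 h1
      simp [this]
  | insert v t hv ih =>
    obtain ⟨s, hs⟩ := ih
    obtain ⟨s', hs'⟩ := fourier_motzkin s v
    refine ⟨s', fun x => ?_⟩
    rw [← hs', Finset.coe_insert, Submodule.mem_span_insert]
    constructor
    · rintro ⟨a, z, hz, rfl⟩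
      refine ⟨a.1, a.2, ?_⟩
      have : (a • v + z : Euc d) - a.1 • v = z := by
        rw [show (a • v : Euc d) = a.1 • v from rfl]; abel
      rw [this]
      exact (hs z).1 hz
    · rintro ⟨a, ha, h⟩
      exact ⟨⟨a, ha⟩, x - a • v, (hs _).2 h, by
        rw [show ((⟨a, ha⟩ : {c : ℝ // 0 ≤ c}) • v : Euc d) = a • v from rfl]; abel⟩

lemma inner_nonneg_of_mem_hull {s : Set (Euc d)} {x y : Euc d}
    (hy : y ∈ PointedCone.hull ℝ s) (hx : ∀ h ∈ s, 0 ≤ ⟪h, x⟫_ℝ) : 0 ≤ ⟪y, x⟫_ℝ := by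
  induction hy using Submodule.span_induction with
  | mem h hh => exact hx h hh
  | zero => simp
  | add a b _ _ ha hb => rw [inner_add_left]; linarith
  | smul a y _ hy =>
    rw [show (a • y : Euc d) = a.1 • y from rfl, real_inner_smul_left]
    exact mul_nonneg a.2 hy

/-- Finite intersections of half-spaces are finitely generated. -/
lemma minkowski (s : Finset (Euc d)) : ∃ t : Finset (Euc d), ∀ x : Euc d,
    x ∈ PointedCone.hull ℝ (t : Set (Euc d)) ↔ ∀ h ∈ s, 0 ≤ ⟪h, x⟫_ℝ := by
  obtain ⟨t, ht⟩ := weyl s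
  refine ⟨t, fun x => ⟨fun hx h hh => ?_, fun hx => ?_⟩⟩
  · rw [real_inner_comm]
    refine inner_nonneg_of_mem_hull hx fun k hk => ?_
    exact (ht h).1 (Submodule.subset_span hh) k hk
  · obtain ⟨s2, hs2⟩ := weyl t
    rw [hs2]
    intro h hh
    refine inner_nonneg_of_mem_hull (s := (s : Set (Euc d))) ?_ (fun k hk => hx k hk)
    rw [ht]
    intro k hk
    rw [real_inner_comm]
    exact (hs2 k).1 (Submodule.subset_span hk) h hh

lemma farkas {C : PointedCone ℝ (Euc d)} (hC : C.FG) {x : Euc d} (hx : x ∉ C) :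
    ∃ h : Euc d, (∀ y ∈ C, 0 ≤ ⟪h, y⟫_ℝ) ∧ ⟪h, x⟫_ℝ < 0 := by
  obtain ⟨t, rfl⟩ := hC
  obtain ⟨s, hs⟩ := weyl t
  have : ¬ ∀ h ∈ s, 0 ≤ ⟪h, x⟫_ℝ := fun h => hx ((hs x).2 h)
  push Not at this
  obtain ⟨h, hh, hlt⟩ := this
  exact ⟨h, fun y hy => (hs y).1 hy h hh, hlt⟩

lemma isPolyhedralCone_of_fg {C : PointedCone ℝ (Euc d)} (hC : C.FG) :
    IsPolyhedralCone (C : Set (Euc d)) := by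
  obtain ⟨n, v, hv⟩ := Submodule.fg_iff_exists_fin_generating_family.1 hC
  refine ⟨n, v, ?_⟩
  ext x
  rw [← hv, SetLike.mem_coe, Submodule.mem_span_range_iff_exists_fun]
  constructor
  · rintro ⟨c, rfl⟩
    exact ⟨fun i => (c i).1, fun i => (c i).2, rfl⟩
  · rintro ⟨c, hc, rfl⟩
    exact ⟨fun i => ⟨c i, hc i⟩, rfl⟩

lemma isPolyhedralCone_of_halfspaces (s : Finset (Euc d)) :
    IsPolyhedralCone {x : Euc d | ∀ h ∈ s, 0 ≤ ⟪h, x⟫_ℝ} := by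
  obtain ⟨t, ht⟩ := minkowski s
  have : {x : Euc d | ∀ h ∈ s, 0 ≤ ⟪h, x⟫_ℝ} = (PointedCone.hull ℝ (t : Set (Euc d)) : Set _) := by
    ext x; exact (ht x).symm
  rw [this]
  exact isPolyhedralCone_of_fg ⟨t, rfl⟩

lemma fg_ofSubmodule (W : Submodule ℝ (Euc d)) : (PointedCone.ofSubmodule W).FG := by
  classical
  obtain ⟨t, ht⟩ : W.FG := IsNoetherian.noetherian W
  refine ⟨t ∪ t.image (fun x => -x), le_antisymm ?_ ?_⟩
  · rw [Submodule.span_le]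
    intro x hx
    have hsub : ∀ y ∈ t, y ∈ W := fun y hy => ht ▸ Submodule.subset_span hy
    rcases Finset.mem_union.1 hx with h | h
    · exact hsub x h
    · obtain ⟨y, hy, rfl⟩ := Finset.mem_image.1 h
      exact W.neg_mem (hsub y hy)
  · intro x hx
    replace hx : x ∈ Submodule.span ℝ (t : Set (Euc d)) := ht ▸ hx
    clear ht
    have key : x ∈ PointedCone.hull ℝ ((t ∪ t.image (fun x => -x) : Finset (Euc d)) : Set (Euc d)) ∧
        -x ∈ PointedCone.hull ℝ ((t ∪ t.image (fun x => -x) : Finset (Euc d)) : Set (Euc d)) := by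
      induction hx using Submodule.span_induction with
      | mem h hh =>
        exact ⟨Submodule.subset_span (Finset.mem_union_left _ hh),
          Submodule.subset_span (Finset.mem_union_right _ (Finset.mem_image_of_mem _ hh))⟩
      | zero => simp
      | add a b _ _ ha hb =>
        exact ⟨add_mem ha.1 hb.1, by rw [neg_add]; exact add_mem ha.2 hb.2⟩
      | smul a y _ hy =>
        rcases le_total 0 a with h | h
        · exact ⟨PointedCone.smul_mem _ h hy.1, by
            rw [← smul_neg]; exact PointedCone.smul_mem _ h hy.2⟩
        · constructor
          · have := PointedCone.smul_mem _ (neg_nonneg.2 h) hy.2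
            rwa [smul_neg, neg_smul, neg_neg] at this
          · have := PointedCone.smul_mem _ (neg_nonneg.2 h) hy.1
            rwa [neg_smul] at this
    exact key.1

end GramAngles

set_option linter.unusedSectionVars false
namespace GramAngles
variable {d : ℕ}

lemma alpha_submodule (α : ConeAngle d) (W : Submodule ℝ (Euc d)) [Decidable (W = ⊤)] :
    α.toFun (W : Set (Euc d)) = if W = ⊤ then 1 else 0 := by
  split_ifs with h
  · subst h; simpa using α.norm'
  · apply α.simple'
    · exact isPolyhedralCone_of_fg (fg_ofSubmodule W)
    · have h1 : vectorSpan ℝ (W : Set (Euc d)) ≤ W := by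
        rw [vectorSpan_def, Submodule.span_le]
        rintro x ⟨a, ha, b, hb, rfl⟩
        exact W.sub_mem ha hb
      have h2 := Submodule.finrank_lt h
      rw [finrank_euclideanSpace, Fintype.card_fin] at h2
      exact (Submodule.finrank_mono h1).trans_lt h2

lemma mem_sup_hull_singleton {C : PointedCone ℝ (Euc d)} {b x : Euc d} :
    x ∈ C ⊔ PointedCone.hull ℝ {b} ↔ ∃ y ∈ C, ∃ t : ℝ, 0 ≤ t ∧ x = y + t • b := by
  rw [Submodule.mem_sup]
  constructor
  · rintro ⟨y, hy, w, hw, rfl⟩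
    obtain ⟨a, rfl⟩ := Submodule.mem_span_singleton.1 hw
    exact ⟨y, hy, a.1, a.2, rfl⟩
  · rintro ⟨y, hy, t, ht, rfl⟩
    exact ⟨y, hy, t • b, PointedCone.smul_mem _ ht (Submodule.subset_span rfl), rfl⟩

lemma mem_sup_span_singleton {C : PointedCone ℝ (Euc d)} {b x : Euc d} :
    x ∈ C ⊔ PointedCone.ofSubmodule (Submodule.span ℝ {b}) ↔
      ∃ y ∈ C, ∃ t : ℝ, x = y + t • b := by
  rw [Submodule.mem_sup]
  constructor
  · rintro ⟨y, hy, w, hw, rfl⟩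
    obtain ⟨a, rfl⟩ := Submodule.mem_span_singleton.1 (PointedCone.mem_ofSubmodule_iff.1 hw)
    exact ⟨y, hy, a, rfl⟩
  · rintro ⟨y, hy, t, rfl⟩
    exact ⟨y, hy, t • b, PointedCone.mem_ofSubmodule_iff.2
      (Submodule.smul_mem _ _ (Submodule.subset_span rfl)), rfl⟩

lemma fg_hull_singleton (b : Euc d) : (PointedCone.hull ℝ {b}).FG := ⟨{b}, by simp⟩

/-- The key valuation identity. -/
lemma valuation_identity (α : ConeAngle d) {C : PointedCone ℝ (Euc d)} (hC : C.FG) (b : Euc d) :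
    α.toFun (C ⊔ PointedCone.hull ℝ {b} : PointedCone ℝ (Euc d)) +
      α.toFun (C ⊔ PointedCone.hull ℝ {-b} : PointedCone ℝ (Euc d)) =
    α.toFun (C ⊔ PointedCone.ofSubmodule (Submodule.span ℝ {b}) : PointedCone ℝ (Euc d)) +
      α.toFun C := by
  have hU : ((C ⊔ PointedCone.hull ℝ {b} : PointedCone ℝ (Euc d)) : Set (Euc d)) ∪
      (C ⊔ PointedCone.hull ℝ {-b} : PointedCone ℝ (Euc d)) =
      (C ⊔ PointedCone.ofSubmodule (Submodule.span ℝ {b}) : PointedCone ℝ (Euc d)) := by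
    ext x
    simp only [Set.mem_union, SetLike.mem_coe, mem_sup_hull_singleton, mem_sup_span_singleton]
    constructor
    · rintro (⟨y, hy, t, ht, rfl⟩ | ⟨y, hy, t, ht, rfl⟩)
      · exact ⟨y, hy, t, rfl⟩
      · exact ⟨y, hy, -t, by simp⟩
    · rintro ⟨y, hy, t, rfl⟩
      rcases le_total 0 t with h | h
      · exact Or.inl ⟨y, hy, t, h, rfl⟩
      · exact Or.inr ⟨y, hy, -t, by linarith, by simp⟩
  have hI : ((C ⊔ PointedCone.hull ℝ {b} : PointedCone ℝ (Euc d)) : Set (Euc d)) ∩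
      (C ⊔ PointedCone.hull ℝ {-b} : PointedCone ℝ (Euc d)) = C := by
    ext x
    simp only [Set.mem_inter_iff, SetLike.mem_coe, mem_sup_hull_singleton]
    constructor
    · rintro ⟨⟨y, hy, t, ht, hx⟩, ⟨y', hy', t', ht', hx'⟩⟩
      rcases eq_or_lt_of_le ht with h | h
      · rw [hx, ← h]; simpa using hy
      have hpos : 0 < t + t' := by linarith
      have : x = (t + t')⁻¹ • (t' • y + t • y') := by
        rw [eq_inv_smul_iff₀ hpos.ne']
        have e1 : t' • x = t' • y + (t' * t) • b := by rw [hx, smul_add, smul_smul]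
        have e2 : t • x = t • y' - (t' * t) • b := by
          rw [hx', smul_add, smul_smul, smul_neg, mul_comm t t']; abel
        rw [add_smul, e1, e2]; abel
      rw [this]
      exact PointedCone.smul_mem _ (inv_nonneg.2 hpos.le)
        (add_mem (PointedCone.smul_mem _ ht' hy) (PointedCone.smul_mem _ ht hy'))
    · intro hx
      exact ⟨⟨x, hx, 0, le_rfl, by simp⟩, ⟨x, hx, 0, le_rfl, by simp⟩⟩
  have h1 := hC.sup (fg_hull_singleton b)
  have h2 := hC.sup (fg_hull_singleton (-b))
  have h3 := hC.sup (fg_ofSubmodule (Submodule.span ℝ {b}))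
  have := α.union' _ _ (isPolyhedralCone_of_fg h1) (isPolyhedralCone_of_fg h2)
    (by rw [hU]; exact isPolyhedralCone_of_fg h3) (by rw [hI]; exact isPolyhedralCone_of_fg hC)
  rw [hU, hI] at this
  linarith

lemma small_perturb {ι : Type*} (A : Finset ι) (a b : ι → ℝ) (h : ∀ i ∈ A, 0 < a i) :
    ∃ t : ℝ, 0 < t ∧ ∀ i ∈ A, 0 < a i + t * b i := by
  have h1 : ∀ i ∈ A, ∀ᶠ t in nhdsWithin (0 : ℝ) (Set.Ioi 0), 0 < a i + t * b i := by
    intro i hi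
    have : Filter.Tendsto (fun t : ℝ => a i + t * b i) (nhds 0) (nhds (a i + 0 * b i)) := by
      apply Continuous.tendsto; fun_prop
    have h2 : ∀ᶠ t in nhds (0:ℝ), 0 < a i + t * b i :=
      this.eventually (lt_mem_nhds (by simpa using h i hi))
    exact nhdsWithin_le_nhds h2
  have h2 := (Filter.eventually_all_finset A).2 h1
  obtain ⟨t, ht, ht'⟩ := (h2.and self_mem_nhdsWithin).exists
  exact ⟨t, ht', ht⟩

variable {ι : Type*} [Fintype ι] [DecidableEq ι]

/-- The open region condition. -/
def inReg (z : ι → Euc d) (A : Finset ι) (W : Submodule ℝ (Euc d)) (ε : ι → SignType)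
    (c : Euc d) : Prop := c ∈ Wᗮ ∧ ∀ i ∈ A, 0 < (ε i : ℝ) * ⟪c, z i⟫_ℝ

/-- Topes of the arrangement `z_i^⊥` (`i ∈ A`) in `W^⊥`. -/
def topes (z : ι → Euc d) (A : Finset ι) (W : Submodule ℝ (Euc d)) : Set (ι → SignType) :=
  {ε | (∀ i ∉ A, ε i = 0) ∧ ∃ c, inReg z A W ε c}

def tcone (z : ι → Euc d) (A : Finset ι) (W : Submodule ℝ (Euc d)) (ε : ι → SignType) :
    PointedCone ℝ (Euc d) :=
  PointedCone.ofSubmodule W ⊔ PointedCone.hull ℝ ((fun i => -((ε i : ℝ) • z i)) '' (A : Set ι))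

lemma tcone_fg (z : ι → Euc d) (A : Finset ι) (W : Submodule ℝ (Euc d)) (ε : ι → SignType) :
    (tcone z A W ε).FG :=
  (fg_ofSubmodule W).sup ⟨A.image (fun i => -((ε i : ℝ) • z i)), by rw [Finset.coe_image]⟩

open Classical in
def fsum (α : ConeAngle d) (z : ι → Euc d) (A : Finset ι) (W : Submodule ℝ (Euc d)) : ℝ :=
  ∑ ε ∈ Finset.univ.filter (fun ε => ε ∈ topes z A W), α.toFun (tcone z A W ε)

lemma upd_mem_topes {z : ι → Euc d} {A : Finset ι} {W : Submodule ℝ (Euc d)}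
    {δ : ι → SignType} {b : ι} (hb : b ∉ A) (hδ : ∀ i ∉ A, δ i = 0) (s : SignType) :
    Function.update δ b s ∈ topes z (insert b A) W ↔
      ∃ c, inReg z A W δ c ∧ 0 < (s : ℝ) * ⟪c, z b⟫_ℝ := by
  have hne : ∀ i ∈ A, i ≠ b := fun i hi h => hb (h ▸ hi)
  constructor
  · rintro ⟨-, c, hc, h⟩
    refine ⟨c, ⟨hc, fun i hi => ?_⟩, ?_⟩
    · have := h i (Finset.mem_insert_of_mem hi)
      rwa [Function.update_of_ne (hne i hi)] at this
    · have := h b (Finset.mem_insert_self _ _)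
      rwa [Function.update_self] at this
  · rintro ⟨c, ⟨hc, h⟩, h'⟩
    refine ⟨fun i hi => ?_, c, hc, fun i hi => ?_⟩
    · rw [Finset.mem_insert, not_or] at hi
      rw [Function.update_of_ne hi.1, hδ i hi.2]
    · rcases Finset.mem_insert.1 hi with rfl | hi
      · rwa [Function.update_self]
      · rw [Function.update_of_ne (hne i hi)]; exact h i hi

lemma tcone_upd {z : ι → Euc d} {A : Finset ι} {W : Submodule ℝ (Euc d)}
    {δ : ι → SignType} {b : ι} (hb : b ∉ A) (s : SignType) :
    tcone z (insert b A) W (Function.update δ b s) =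
      tcone z A W δ ⊔ PointedCone.hull ℝ {-((s : ℝ) • z b)} := by
  have hne : ∀ i ∈ A, i ≠ b := fun i hi h => hb (h ▸ hi)
  unfold tcone
  rw [sup_assoc, ← Submodule.span_union, Finset.coe_insert, Set.image_insert_eq,
    Function.update_self, Set.union_singleton]
  congr 3
  apply Set.image_congr
  intro i hi
  rw [Function.update_of_ne (hne i hi)]

lemma tcone_sup {z : ι → Euc d} {A : Finset ι} {W : Submodule ℝ (Euc d)}
    {δ : ι → SignType} {b : ι} :
    tcone z A (W ⊔ Submodule.span ℝ {z b}) δ =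
      tcone z A W δ ⊔ PointedCone.ofSubmodule (Submodule.span ℝ {z b}) := by
  unfold tcone
  rw [PointedCone.ofSubmodule_sup, sup_assoc, sup_assoc,
    sup_comm (PointedCone.ofSubmodule (Submodule.span ℝ {z b}))]

lemma exists_perp {W : Submodule ℝ (Euc d)} {v : Euc d} (hv : v ∉ W) :
    ∃ w ∈ Wᗮ, 0 < ⟪w, v⟫_ℝ := by
  refine ⟨v - W.starProjection v, W.sub_starProjection_mem_orthogonal v, ?_⟩
  have h0 : v - W.starProjection v ≠ 0 := by
    intro h
    rw [sub_eq_zero] at h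
    exact hv (h ▸ Submodule.starProjection_apply_mem W v)
  have h1 : ⟪v - W.starProjection v, W.starProjection v⟫_ℝ = 0 := by
    rw [real_inner_comm]
    exact W.sub_starProjection_mem_orthogonal v _ (Submodule.starProjection_apply_mem W v)
  have h2 : ⟪v - W.starProjection v, v⟫_ℝ =
      ⟪v - W.starProjection v, v - W.starProjection v⟫_ℝ := by
    rw [inner_sub_right (v - W.starProjection v) v, h1, sub_zero]
  rw [h2]
  exact real_inner_self_pos.2 h0

lemma inReg_perturb {z : ι → Euc d} {A : Finset ι} {W : Submodule ℝ (Euc d)}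
    {δ : ι → SignType} {c : Euc d} (h : inReg z A W δ c) {w : Euc d} (hw : w ∈ Wᗮ) :
    ∃ t : ℝ, 0 < t ∧ inReg z A W δ (c + t • w) := by
  obtain ⟨t, ht, H⟩ := small_perturb A _ (fun i => (δ i : ℝ) * ⟪w, z i⟫_ℝ) h.2
  refine ⟨t, ht, add_mem h.1 (Submodule.smul_mem _ _ hw), fun i hi => ?_⟩
  have := H i hi
  rw [inner_add_left, real_inner_smul_left]
  linarith

/-- If no point of the region is on the side `s` of `z_b`, then `s z_b` is in the cone. -/
lemma mem_tcone_of_not {z : ι → Euc d} {A : Finset ι} {W : Submodule ℝ (Euc d)}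
    {δ : ι → SignType} (v : Euc d) {c₀ : Euc d} (h₀ : inReg z A W δ c₀)
    (hn : ¬ ∃ c, inReg z A W δ c ∧ 0 < ⟪c, v⟫_ℝ) : v ∈ tcone z A W δ := by
  by_contra hv
  obtain ⟨y, hy, hyv⟩ := farkas (tcone_fg z A W δ) hv
  apply hn
  have hyW : y ∈ Wᗮ := by
    rw [Submodule.mem_orthogonal]
    intro u hu
    have h1 := hy u (Submodule.mem_sup_left (PointedCone.mem_ofSubmodule_iff.2 hu))
    have h2 := hy (-u) (Submodule.mem_sup_left (PointedCone.mem_ofSubmodule_iff.2 (W.neg_mem hu)))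
    rw [inner_neg_right] at h2
    rw [real_inner_comm]; linarith
  have hyi : ∀ i ∈ A, 0 ≤ (δ i : ℝ) * ⟪-y, z i⟫_ℝ := by
    intro i hi
    have h1 := hy _ (Submodule.mem_sup_right (Submodule.subset_span (Set.mem_image_of_mem _ hi)))
    rw [inner_neg_right, inner_smul_right] at h1
    rw [inner_neg_left]; linarith
  obtain ⟨t, ht, H⟩ := small_perturb ({()} : Finset Unit) (fun _ => ⟪-y, v⟫_ℝ)
    (fun _ => ⟪c₀, v⟫_ℝ) (by simpa [inner_neg_left] using hyv)
  refine ⟨-y + t • c₀, ⟨add_mem (Submodule.neg_mem _ hyW) (Submodule.smul_mem _ _ h₀.1),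
    fun i hi => ?_⟩, ?_⟩
  · rw [inner_add_left, real_inner_smul_left]
    have := hyi i hi
    have := mul_pos ht (h₀.2 i hi)
    linarith
  · have := H () (by simp)
    rw [inner_add_left, real_inner_smul_left]; exact this

lemma sup_hull_of_mem {C : PointedCone ℝ (Euc d)} {v : Euc d} (hv : v ∈ C) :
    C ⊔ PointedCone.hull ℝ {v} = C := by
  rw [sup_eq_left, Submodule.span_le, Set.singleton_subset_iff]; exact hv

open Classical in
lemma fiber_identity (α : ConeAngle d) {z : ι → Euc d} {A : Finset ι} {W : Submodule ℝ (Euc d)}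
    {δ : ι → SignType} {b : ι} (hb : b ∉ A) (hδ : δ ∈ topes z A W) (hzb : z b ∉ W) :
    (if Function.update δ b 1 ∈ topes z (insert b A) W then
        α.toFun (tcone z (insert b A) W (Function.update δ b 1)) else 0) +
    (if Function.update δ b (-1) ∈ topes z (insert b A) W then
        α.toFun (tcone z (insert b A) W (Function.update δ b (-1))) else 0) =
    α.toFun (tcone z A W δ) +
    (if δ ∈ topes z A (W ⊔ Submodule.span ℝ {z b}) then
        α.toFun (tcone z A (W ⊔ Submodule.span ℝ {z b}) δ) else 0) := by
  obtain ⟨hδ0, c₀, hc₀⟩ := hδ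
  rw [upd_mem_topes hb hδ0, upd_mem_topes hb hδ0, tcone_upd hb, tcone_upd hb, tcone_sup]
  simp only [SignType.coe_one, SignType.coe_neg, one_mul, one_smul, neg_mul, neg_smul, neg_neg]
  have hperp : ∀ c : Euc d, c ∈ (W ⊔ Submodule.span ℝ {z b})ᗮ ↔ c ∈ Wᗮ ∧ ⟪c, z b⟫_ℝ = 0 := by
    intro c
    rw [← Submodule.inf_orthogonal, Submodule.mem_inf, Submodule.mem_orthogonal_singleton_iff_inner_left]
  have hq : δ ∈ topes z A (W ⊔ Submodule.span ℝ {z b}) ↔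
      ∃ c, inReg z A W δ c ∧ ⟪c, z b⟫_ℝ = 0 := by
    constructor
    · rintro ⟨-, c, hc, h⟩
      exact ⟨c, ⟨((hperp c).1 hc).1, h⟩, ((hperp c).1 hc).2⟩
    · rintro ⟨c, ⟨hc, h⟩, h'⟩
      exact ⟨hδ0, c, (hperp c).2 ⟨hc, h'⟩, h⟩
  obtain ⟨w, hwW, hw⟩ := exists_perp hzb
  have hqpm : (∃ c, inReg z A W δ c ∧ ⟪c, z b⟫_ℝ = 0) ↔
      (∃ c, inReg z A W δ c ∧ 0 < ⟪c, z b⟫_ℝ) ∧ (∃ c, inReg z A W δ c ∧ 0 < -⟪c, z b⟫_ℝ) := by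
    constructor
    · rintro ⟨c, hc, h0⟩
      obtain ⟨t, ht, H⟩ := inReg_perturb hc hwW
      obtain ⟨t', ht', H'⟩ := inReg_perturb hc (Submodule.neg_mem _ hwW)
      refine ⟨⟨_, H, ?_⟩, ⟨_, H', ?_⟩⟩
      · rw [inner_add_left, real_inner_smul_left, h0]; have := mul_pos ht hw; linarith
      · rw [inner_add_left, real_inner_smul_left, h0, inner_neg_left]
        have := mul_pos ht' hw; linarith
    · rintro ⟨⟨c, hc, h⟩, ⟨c', hc', h'⟩⟩
      refine ⟨(-⟪c', z b⟫_ℝ) • c + ⟪c, z b⟫_ℝ • c', ⟨add_mem (Submodule.smul_mem _ _ hc.1)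
        (Submodule.smul_mem _ _ hc'.1), fun i hi => ?_⟩, ?_⟩
      · rw [inner_add_left, real_inner_smul_left, real_inner_smul_left]
        have := mul_pos h' (hc.2 i hi)
        have := mul_pos h (hc'.2 i hi)
        linarith
      · rw [inner_add_left, real_inner_smul_left, real_inner_smul_left]; ring
  have hpm : (∃ c, inReg z A W δ c ∧ 0 < ⟪c, z b⟫_ℝ) ∨
      (∃ c, inReg z A W δ c ∧ 0 < -⟪c, z b⟫_ℝ) := by
    rcases lt_trichotomy 0 ⟪c₀, z b⟫_ℝ with h | h | h
    · exact Or.inl ⟨c₀, hc₀, h⟩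
    · exact Or.inl (hqpm.1 ⟨c₀, hc₀, h.symm⟩).1
    · exact Or.inr ⟨c₀, hc₀, by linarith⟩
  rw [hq, hqpm]
  by_cases hp : ∃ c, inReg z A W δ c ∧ 0 < ⟪c, z b⟫_ℝ
  · by_cases hm : ∃ c, inReg z A W δ c ∧ 0 < -⟪c, z b⟫_ℝ
    · rw [if_pos hp, if_pos hm, if_pos ⟨hp, hm⟩]
      have := valuation_identity α (tcone_fg z A W δ) (z b)
      linarith
    · rw [if_pos hp, if_neg hm, if_neg (fun h => hm h.2), sup_hull_of_mem]
      refine mem_tcone_of_not _ hc₀ ?_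
      simpa only [inner_neg_right] using hm
  · have hm := hpm.resolve_left hp
    rw [if_neg hp, if_pos hm, if_neg (fun h => hp h.1), sup_hull_of_mem, zero_add, add_zero]
    exact mem_tcone_of_not _ hc₀ hp

lemma sign_eq_of_pos {s : SignType} {x : ℝ} (h : 0 < (s : ℝ) * x) : s = 1 ∨ s = -1 := by
  cases s
  · simp at h
  · right; rfl
  · left; rfl

lemma fsum_insert (α : ConeAngle d) {z : ι → Euc d} {A : Finset ι} {W : Submodule ℝ (Euc d)}
    {b : ι} (hb : b ∉ A) (hzb : z b ∉ W) :
    fsum α z (insert b A) W = fsum α z A W + fsum α z A (W ⊔ Submodule.span ℝ {z b}) := by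
  classical
  have hsub : ∀ δ ∈ topes z A (W ⊔ Submodule.span ℝ {z b}), δ ∈ topes z A W := by
    rintro δ ⟨h0, c, hc, h⟩
    exact ⟨h0, c, Submodule.orthogonal_le le_sup_left hc, h⟩
  have hmaps : ∀ ε ∈ Finset.univ.filter (fun ε => ε ∈ topes z (insert b A) W),
      Function.update ε b 0 ∈ Finset.univ.filter (fun ε => ε ∈ topes z A W) := by
    intro ε hε
    obtain ⟨h0, c, hc, h⟩ := (Finset.mem_filter.1 hε).2
    refine Finset.mem_filter.2 ⟨Finset.mem_univ _, fun i hi => ?_, c, hc, fun i hi => ?_⟩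
    · by_cases hib : i = b
      · subst hib; simp
      · rw [Function.update_of_ne hib]; exact h0 i (by simp [hi, hib])
    · have hib : i ≠ b := fun h => hb (h ▸ hi)
      rw [Function.update_of_ne hib]
      exact h i (Finset.mem_insert_of_mem hi)
  unfold fsum
  rw [← Finset.sum_fiberwise_of_maps_to hmaps]
  have h2 : ∑ δ ∈ Finset.univ.filter (fun ε => ε ∈ topes z A (W ⊔ Submodule.span ℝ {z b})),
      α.toFun (tcone z A (W ⊔ Submodule.span ℝ {z b}) δ) =
      ∑ δ ∈ Finset.univ.filter (fun ε => ε ∈ topes z A W),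
      (if δ ∈ topes z A (W ⊔ Submodule.span ℝ {z b}) then
        α.toFun (tcone z A (W ⊔ Submodule.span ℝ {z b}) δ) else 0) := by
    rw [← Finset.sum_filter, Finset.filter_filter]
    refine Finset.sum_congr ?_ fun _ _ => rfl
    ext δ
    simp only [Finset.mem_filter, Finset.mem_univ, true_and]
    exact ⟨fun h => ⟨hsub δ h, h⟩, fun h => h.2⟩
  rw [h2, ← Finset.sum_add_distrib]
  refine Finset.sum_congr rfl fun δ hδ => ?_
  replace hδ := (Finset.mem_filter.1 hδ).2
  rw [← fiber_identity α hb hδ hzb, Finset.filter_filter]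
  have hne : Function.update δ b 1 ≠ Function.update δ b (-1) := by
    intro h
    have := congrFun h b
    simp at this
  have : Finset.univ.filter (fun ε => ε ∈ topes z (insert b A) W ∧ Function.update ε b 0 = δ) =
      ({Function.update δ b 1, Function.update δ b (-1)} : Finset (ι → SignType)).filter
        (fun ε => ε ∈ topes z (insert b A) W) := by
    ext ε
    simp only [Finset.mem_filter, Finset.mem_univ, true_and, Finset.mem_insert,
      Finset.mem_singleton]
    constructor
    · rintro ⟨h, rfl⟩
      refine ⟨?_, h⟩
      obtain ⟨_, c, hc⟩ := h
      have := sign_eq_of_pos (hc.2 b (Finset.mem_insert_self _ _))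
      simp only [Function.update_idem]
      rcases this with h | h
      · left; rw [← h, Function.update_eq_self]
      · right; rw [← h, Function.update_eq_self]
    · have hb0 := hδ.1 b hb
      rintro ⟨rfl | rfl, h⟩
      · exact ⟨h, by rw [Function.update_idem, ← hb0, Function.update_eq_self]⟩
      · exact ⟨h, by rw [Function.update_idem, ← hb0, Function.update_eq_self]⟩
  rw [this, Finset.sum_filter, Finset.sum_pair hne]

open Classical in
/-- The interior angle sum in closed (Whitney) form. -/
lemma fsum_closed (α : ConeAngle d) (z : ι → Euc d) (A : Finset ι) (W : Submodule ℝ (Euc d)) :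
    (-1 : ℝ) ^ (d - Module.finrank ℝ W) * fsum α z A W =
      ∑ B ∈ A.powerset, (-1 : ℝ) ^ B.card *
        (if W ⊔ Submodule.span ℝ (z '' (B : Set ι)) = ⊤ then 1 else 0) := by
  induction A using Finset.induction_on generalizing W with
  | empty =>
    have h1 : Finset.univ.filter (fun ε => ε ∈ topes z ∅ W) = {fun _ => 0} := by
      ext ε
      simp only [Finset.mem_filter, Finset.mem_univ, true_and, Finset.mem_singleton]
      constructor
      · rintro ⟨h, -⟩; ext i; rw [h i (by simp)]
      · rintro rfl; exact ⟨fun _ _ => rfl, 0, by simp, by simp⟩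
    have h2 : tcone z ∅ W (fun _ => 0) = PointedCone.ofSubmodule W := by simp [tcone]
    unfold fsum
    rw [h1, Finset.sum_singleton, h2, PointedCone.coe_ofSubmodule, alpha_submodule]
    by_cases hW : W = ⊤
    · subst hW; simp
    · simp [hW]
  | insert b A hb ih =>
    have hR : ∑ B ∈ (insert b A).powerset, (-1 : ℝ) ^ B.card *
        (if W ⊔ Submodule.span ℝ (z '' (B : Set ι)) = ⊤ then 1 else 0) =
        ∑ B ∈ A.powerset, (-1 : ℝ) ^ B.card *
          (if W ⊔ Submodule.span ℝ (z '' (B : Set ι)) = ⊤ then 1 else 0) -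
        ∑ B ∈ A.powerset, (-1 : ℝ) ^ B.card *
          (if (W ⊔ Submodule.span ℝ {z b}) ⊔ Submodule.span ℝ (z '' (B : Set ι)) = ⊤
            then 1 else 0) := by
      rw [Finset.sum_powerset_insert hb, sub_eq_add_neg, ← Finset.sum_neg_distrib]
      congr 1
      refine Finset.sum_congr rfl fun B hB => ?_
      have hbB : b ∉ B := fun h => hb (Finset.mem_powerset.1 hB h)
      rw [Finset.card_insert_of_notMem hbB, Finset.coe_insert, Set.image_insert_eq,
        Submodule.span_insert, ← sup_assoc, pow_succ]
      ring
    rw [hR, ← ih, ← ih]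
    by_cases hzb : z b ∈ W
    · have h1 : W ⊔ Submodule.span ℝ {z b} = W := by
        rw [sup_eq_left, Submodule.span_le, Set.singleton_subset_iff]; exact hzb
      have h2 : fsum α z (insert b A) W = 0 := by
        unfold fsum
        rw [Finset.filter_false_of_mem, Finset.sum_empty]
        rintro ε - ⟨-, c, hc, h⟩
        have := h b (Finset.mem_insert_self _ _)
        rw [real_inner_comm, hc _ hzb, mul_zero] at this
        exact lt_irrefl _ this
      rw [h1, h2]; ring
    · have h1 := Submodule.finrank_sup_span_singleton hzb
      have h2 := Submodule.finrank_le (W ⊔ Submodule.span ℝ {z b})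
      rw [finrank_euclideanSpace, Fintype.card_fin] at h2
      rw [fsum_insert α hb hzb, h1]
      have : d - Module.finrank ℝ W = (d - (Module.finrank ℝ W + 1)) + 1 := by omega
      rw [this, pow_succ]; ring

end GramAngles

set_option linter.unusedSectionVars false
namespace GramAngles
variable {d : ℕ} {ι : Type*} [Fintype ι] [DecidableEq ι]

lemma alpha_zero_of_subset_hyperplane (α : ConeAngle d) {C : Set (Euc d)}
    (hC : IsPolyhedralCone C) {a : Euc d} (ha : a ≠ 0) (h : ∀ x ∈ C, ⟪a, x⟫_ℝ = 0) :
    α.toFun C = 0 := by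
  apply α.simple' C hC
  have h1 : vectorSpan ℝ C ≤ (Submodule.span ℝ {a})ᗮ := by
    rw [vectorSpan_def, Submodule.span_le]
    rintro x ⟨u, hu, v, hv, rfl⟩
    rw [SetLike.mem_coe, Submodule.mem_orthogonal_singleton_iff_inner_right]
    simp [inner_sub_right, h u hu, h v hv]
  have h2 : (Submodule.span ℝ {a})ᗮ ≠ ⊤ := by
    intro h
    have : a ∈ (Submodule.span ℝ {a})ᗮ := h ▸ Submodule.mem_top
    rw [Submodule.mem_orthogonal_singleton_iff_inner_right, inner_self_eq_zero] at this
    exact ha this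
  have h3 := Submodule.finrank_lt h2
  rw [finrank_euclideanSpace, Fintype.card_fin] at h3
  exact (Submodule.finrank_mono h1).trans_lt h3

/-- Closed region of the arrangement `a_i^⊥`. -/
def ocone (a : ι → Euc d) (A : Finset ι) (ε : ι → SignType) : Set (Euc d) :=
  {c | ∀ i ∈ A, 0 ≤ (ε i : ℝ) * ⟪c, a i⟫_ℝ}

lemma ocone_eq (a : ι → Euc d) (A : Finset ι) (ε : ι → SignType) [DecidableEq (Euc d)] :
    ocone a A ε = {x | ∀ h ∈ A.image (fun i => (ε i : ℝ) • a i), 0 ≤ ⟪h, x⟫_ℝ} := by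
  ext x
  simp only [ocone, Set.mem_ofPred_eq, Finset.mem_image, forall_exists_index, and_imp,
    forall_apply_eq_imp_iff₂, real_inner_smul_left]
  simp only [real_inner_comm]

lemma ocone_poly (a : ι → Euc d) (A : Finset ι) (ε : ι → SignType) :
    IsPolyhedralCone (ocone a A ε) := by
  classical
  rw [ocone_eq]; exact isPolyhedralCone_of_halfspaces _

lemma ocone_inter_poly (a : ι → Euc d) (A : Finset ι) (ε ε' : ι → SignType) :
    IsPolyhedralCone (ocone a A ε ∩ ocone a A ε') := by
  classical
  have := isPolyhedralCone_of_halfspaces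
    (A.image (fun i => (ε i : ℝ) • a i) ∪ A.image (fun i => (ε' i : ℝ) • a i))
  convert this using 1
  rw [ocone_eq, ocone_eq]
  ext x
  simp only [Set.mem_inter_iff, Set.mem_ofPred_eq, Finset.mem_union]
  constructor
  · rintro ⟨h1, h2⟩ h (hh | hh)
    exacts [h1 h hh, h2 h hh]
  · intro H
    exact ⟨fun h hh => H h (Or.inl hh), fun h hh => H h (Or.inr hh)⟩

lemma mem_ocone_upd {a : ι → Euc d} {A : Finset ι} {δ : ι → SignType} {b : ι} (hb : b ∉ A)
    (s : SignType) (x : Euc d) :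
    x ∈ ocone a (insert b A) (Function.update δ b s) ↔
      x ∈ ocone a A δ ∧ 0 ≤ (s : ℝ) * ⟪x, a b⟫_ℝ := by
  have hne : ∀ i ∈ A, i ≠ b := fun i hi h => hb (h ▸ hi)
  constructor
  · intro h
    refine ⟨fun i hi => ?_, ?_⟩
    · have := h i (Finset.mem_insert_of_mem hi)
      rwa [Function.update_of_ne (hne i hi)] at this
    · have := h b (Finset.mem_insert_self _ _)
      rwa [Function.update_self] at this
  · rintro ⟨h, h'⟩ i hi
    rcases Finset.mem_insert.1 hi with rfl | hi
    · rwa [Function.update_self]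
    · rw [Function.update_of_ne (hne i hi)]; exact h i hi

lemma ocone_split (α : ConeAngle d) {a : ι → Euc d} {A : Finset ι} {δ : ι → SignType} {b : ι}
    (hb : b ∉ A) (hab : a b ≠ 0) :
    α.toFun (ocone a (insert b A) (Function.update δ b 1)) +
      α.toFun (ocone a (insert b A) (Function.update δ b (-1))) = α.toFun (ocone a A δ) := by
  have hU : ocone a (insert b A) (Function.update δ b 1) ∪
      ocone a (insert b A) (Function.update δ b (-1)) = ocone a A δ := by
    ext x
    rw [Set.mem_union, mem_ocone_upd hb, mem_ocone_upd hb, ← and_or_left, and_iff_left_iff_imp]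
    intro _
    simp only [SignType.coe_one, SignType.coe_neg, one_mul, neg_mul]
    rcases le_total 0 ⟪x, a b⟫_ℝ with h | h
    · exact Or.inl h
    · exact Or.inr (by linarith)
  have := α.union' _ _ (ocone_poly a (insert b A) (Function.update δ b 1))
    (ocone_poly a (insert b A) (Function.update δ b (-1))) (by rw [hU]; exact ocone_poly _ _ _)
    (ocone_inter_poly _ _ _ _)
  rw [hU, alpha_zero_of_subset_hyperplane α (ocone_inter_poly _ _ _ _) hab] at this
  · linarith
  · rintro x ⟨h1, h2⟩
    rw [mem_ocone_upd hb] at h1 h2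
    have h1 := h1.2
    have h2 := h2.2
    simp only [SignType.coe_one, SignType.coe_neg, one_mul, neg_mul] at h1 h2
    rw [real_inner_comm]; linarith

def allSigns (A : Finset ι) : Set (ι → SignType) := {ε | ∀ i, ε i ≠ 0 ↔ i ∈ A}

lemma sign_ne_zero' {s : SignType} (h : s ≠ 0) : s = 1 ∨ s = -1 := by
  cases s
  · exact absurd rfl h
  · right; rfl
  · left; rfl

open Classical in
lemma sum_allSigns (α : ConeAngle d) (a : ι → Euc d) (A : Finset ι) (ha : ∀ i ∈ A, a i ≠ 0) :
    ∑ ε ∈ Finset.univ.filter (fun ε => ε ∈ allSigns A), α.toFun (ocone a A ε) = 1 := by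
  induction A using Finset.induction_on with
  | empty =>
    have h1 : Finset.univ.filter (fun ε => ε ∈ allSigns (∅ : Finset ι)) = {fun _ => 0} := by
      ext ε
      simp only [Finset.mem_filter, Finset.mem_univ, true_and, Finset.mem_singleton, allSigns,
        Set.mem_ofPred_eq, Finset.notMem_empty, iff_false, not_not]
      exact ⟨fun h => funext h, fun h i => by rw [h]⟩
    rw [h1, Finset.sum_singleton]
    have : ocone a ∅ (fun _ => 0) = Set.univ := by ext; simp [ocone]
    rw [this, α.norm']
  | insert b A hb ih =>
    rw [← ih (fun i hi => ha i (Finset.mem_insert_of_mem hi))]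
    have hmaps : ∀ ε ∈ Finset.univ.filter (fun ε => ε ∈ allSigns (insert b A)),
        Function.update ε b 0 ∈ Finset.univ.filter (fun ε => ε ∈ allSigns A) := by
      intro ε hε
      replace hε := (Finset.mem_filter.1 hε).2
      refine Finset.mem_filter.2 ⟨Finset.mem_univ _, fun i => ?_⟩
      by_cases hib : i = b
      · subst hib; simp [hb]
      · rw [Function.update_of_ne hib, hε i]; simp [hib]
    rw [← Finset.sum_fiberwise_of_maps_to hmaps]
    refine Finset.sum_congr rfl fun δ hδ => ?_
    replace hδ := (Finset.mem_filter.1 hδ).2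
    have hb0 : δ b = 0 := by by_contra h; exact hb ((hδ b).1 h)
    rw [← ocone_split α hb (ha b (Finset.mem_insert_self _ _)), Finset.filter_filter]
    have hne : Function.update δ b 1 ≠ Function.update δ b (-1) := by
      intro h
      have := congrFun h b
      simp at this
    rw [← Finset.sum_pair (f := fun ε => α.toFun (ocone a (insert b A) ε)) hne]
    refine Finset.sum_congr ?_ fun _ _ => rfl
    ext ε
    simp only [Finset.mem_filter, Finset.mem_univ, true_and, Finset.mem_insert,
      Finset.mem_singleton]
    constructor
    · rintro ⟨h, rfl⟩
      have := sign_ne_zero' ((h b).2 (Finset.mem_insert_self _ _))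
      simp only [Function.update_idem]
      rcases this with h | h
      · left; rw [← h, Function.update_eq_self]
      · right; rw [← h, Function.update_eq_self]
    · have key : ∀ s : SignType, s ≠ 0 → Function.update δ b s ∈ allSigns (insert b A) ∧
          Function.update (Function.update δ b s) b 0 = δ := by
        intro s hs
        refine ⟨fun i => ?_, by rw [Function.update_idem, ← hb0, Function.update_eq_self]⟩
        by_cases hib : i = b
        · subst hib; simp [hs]
        · rw [Function.update_of_ne hib, hδ i]; simp [hib]
      rintro (rfl | rfl)
      · exact key 1 (by decide)
      · exact key (-1) (by decide)

lemma alpha_ocone_zero (α : ConeAngle d) (a : ι → Euc d) (A : Finset ι) (ha : ∀ i ∈ A, a i ≠ 0)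
    (ε : ι → SignType) (hε : ε ∈ allSigns A)
    (hn : ¬ ∃ c, ∀ i ∈ A, 0 < (ε i : ℝ) * ⟪c, a i⟫_ℝ) : α.toFun (ocone a A ε) = 0 := by
  by_contra h0
  apply hn
  have : ∀ i ∈ A, ∃ x ∈ ocone a A ε, ⟪x, a i⟫_ℝ ≠ 0 := by
    intro i hi
    by_contra hc
    push Not at hc
    apply h0
    refine alpha_zero_of_subset_hyperplane α (ocone_poly _ _ _) (ha i hi) fun x hx => ?_
    rw [real_inner_comm]; exact hc x hx
  choose! x hx hx' using this
  refine ⟨∑ j ∈ A, x j, fun i hi => ?_⟩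
  rw [sum_inner, Finset.mul_sum]
  refine Finset.sum_pos' (fun j hj => hx j hj i hi) ⟨i, hi, ?_⟩
  refine lt_of_le_of_ne (hx i hi i hi) (Ne.symm (mul_ne_zero ?_ (hx' i hi)))
  rcases sign_ne_zero' ((hε i).2 hi) with h | h <;> simp [h]

open Classical in
/-- The exterior angle sum is one. -/
lemma sum_topes_ocone (α : ConeAngle d) (z : ι → Euc d) (A : Finset ι) (W : Submodule ℝ (Euc d))
    (hA : ∀ i ∈ A, z i ∉ W) :
    ∑ ε ∈ Finset.univ.filter (fun ε => ε ∈ topes z A W),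
      α.toFun (ocone (fun i => Wᗮ.starProjection (z i)) A ε) = 1 := by
  have ha : ∀ i ∈ A, Wᗮ.starProjection (z i) ≠ 0 := by
    intro i hi h
    rw [Submodule.starProjection_apply_eq_zero_iff, Submodule.orthogonal_orthogonal] at h
    exact hA i hi h
  rw [← sum_allSigns α _ A ha]
  apply Finset.sum_subset
  · intro ε hε
    obtain ⟨h0, c, hc⟩ := (Finset.mem_filter.1 hε).2
    refine Finset.mem_filter.2 ⟨Finset.mem_univ _, fun i => ⟨fun h => ?_, fun h => ?_⟩⟩
    · by_contra hi; exact h (h0 i hi)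
    · intro h'
      have := hc.2 i h
      rw [h'] at this; simp at this
  · intro ε hε hn
    replace hε := (Finset.mem_filter.1 hε).2
    refine alpha_ocone_zero α _ A ha ε hε ?_
    rintro ⟨c, hc⟩
    apply hn
    refine Finset.mem_filter.2 ⟨Finset.mem_univ _, fun i hi => ?_, Wᗮ.starProjection c,
      Submodule.starProjection_apply_mem _ _, fun i hi => ?_⟩
    · by_contra h; exact hi ((hε i).1 h)
    · rw [Submodule.inner_starProjection_left_eq_right]; exact hc i hi

end GramAngles

set_option linter.unusedSectionVars false
namespace GramAngles
variable {d : ℕ} {ι : Type*} [Fintype ι] [DecidableEq ι]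

/-- The candidate face of the zonotope attached to a sign vector. -/
def zface (t : Euc d) (z : ι → Euc d) (σ : ι → SignType) : Set (Euc d) :=
  {x | ∃ l : ι → ℝ, (∀ i, |l i| ≤ 1) ∧ (∀ i, σ i ≠ 0 → l i = (σ i : ℝ)) ∧
    x = t + ∑ i, l i • z i}

/-- The covector of a linear functional. -/
def cov (z : ι → Euc d) (c : Euc d) : ι → SignType := fun i => SignType.sign ⟪c, z i⟫_ℝ

lemma abs_sign_le (s : SignType) : |(s : ℝ)| ≤ 1 := by
  cases s <;> simp

lemma zface_nonempty (t : Euc d) (z : ι → Euc d) (σ : ι → SignType) : (zface t z σ).Nonempty :=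
  ⟨_, fun i => (σ i : ℝ), fun i => abs_sign_le _, fun _ _ => rfl, rfl⟩

lemma zface_convex (t : Euc d) (z : ι → Euc d) (σ : ι → SignType) : Convex ℝ (zface t z σ) := by
  rintro x ⟨l, hl, hl', rfl⟩ y ⟨m, hm, hm', rfl⟩ a b ha hb hab
  refine ⟨fun i => a * l i + b * m i, fun i => ?_, fun i hi => ?_, ?_⟩
  · have h1 := abs_le.1 (hl i)
    have h2 := abs_le.1 (hm i)
    rw [abs_le]
    constructor <;> nlinarith
  · change a * l i + b * m i = _
    rw [hl' i hi, hm' i hi, ← add_mul, hab, one_mul]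
  · simp only [add_smul, mul_smul, Finset.sum_add_distrib, smul_add, Finset.smul_sum]
    have : t = a • t + b • t := by rw [← add_smul, hab, one_smul]
    rw [show t + (∑ x, a • l x • z x + ∑ x, b • m x • z x) = (a • t + b • t) +
      (∑ x, a • l x • z x + ∑ x, b • m x • z x) from by rw [← this]]
    abel

/-- Functional maximality forces coefficients. -/
lemma coeff_of_max (t : Euc d) (z : ι → Euc d) (c : Euc d) (l : ι → ℝ) (hl : ∀ i, |l i| ≤ 1)
    (h : ∀ y ∈ zface t z 0, ⟪c, y⟫_ℝ ≤ ⟪c, t + ∑ i, l i • z i⟫_ℝ) (i : ι)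
    (hi : cov z c i ≠ 0) : l i = (cov z c i : ℝ) := by
  have h1 := h (t + ∑ i, (cov z c i : ℝ) • z i)
    ⟨_, fun i => abs_sign_le _, fun i hi => absurd rfl hi, rfl⟩
  simp only [inner_add_right, inner_sum, inner_smul_right] at h1
  have h2 : ∀ j, 0 ≤ (cov z c j : ℝ) * ⟪c, z j⟫_ℝ - l j * ⟪c, z j⟫_ℝ := by
    intro j
    have h3 := abs_le.1 (hl j)
    simp only [cov]
    rw [sign_mul_self]
    have : l j * ⟪c, z j⟫_ℝ ≤ |l j * ⟪c, z j⟫_ℝ| := le_abs_self _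
    rw [abs_mul] at this
    have : |l j| * |⟪c, z j⟫_ℝ| ≤ 1 * |⟪c, z j⟫_ℝ| := by
      gcongr; exact hl j
    linarith
  have h4 : ∑ j, ((cov z c j : ℝ) * ⟪c, z j⟫_ℝ - l j * ⟪c, z j⟫_ℝ) = 0 := by
    apply le_antisymm
    · rw [Finset.sum_sub_distrib]; linarith
    · exact Finset.sum_nonneg fun j _ => h2 j
  have h5 := (Finset.sum_eq_zero_iff_of_nonneg fun j _ => h2 j).1 h4 i (Finset.mem_univ _)
  have h6 : ⟪c, z i⟫_ℝ ≠ 0 := by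
    intro h; apply hi; simp [cov, h]
  rw [← sub_mul] at h5
  rcases mul_eq_zero.1 h5 with h | h
  · linarith
  · exact absurd h h6

lemma max_of_coeff (t : Euc d) (z : ι → Euc d) (c : Euc d) (x : Euc d) (hx : x ∈ zface t z (cov z c))
    (y : Euc d) (hy : y ∈ zface t z 0) : ⟪c, y⟫_ℝ ≤ ⟪c, x⟫_ℝ := by
  obtain ⟨l, hl, hl', rfl⟩ := hx
  obtain ⟨m, hm, -, rfl⟩ := hy
  simp only [inner_add_right, inner_sum, inner_smul_right]
  refine add_le_add le_rfl (Finset.sum_le_sum fun j _ => ?_)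
  by_cases hj : cov z c j = 0
  · have : ⟪c, z j⟫_ℝ = 0 := by simpa [cov] using hj
    simp [this]
  · rw [hl' j hj]
    simp only [cov]
    rw [sign_mul_self]
    have : m j * ⟪c, z j⟫_ℝ ≤ |m j * ⟪c, z j⟫_ℝ| := le_abs_self _
    rw [abs_mul] at this
    have : |m j| * |⟪c, z j⟫_ℝ| ≤ 1 * |⟪c, z j⟫_ℝ| := by
      gcongr; exact hm j
    linarith

lemma zface_mono {t : Euc d} {z : ι → Euc d} {σ τ : ι → SignType}
    (h : ∀ i, τ i ≠ 0 → σ i = τ i) : zface t z σ ⊆ zface t z τ := by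
  rintro x ⟨l, hl, hl', rfl⟩
  refine ⟨l, hl, fun i hi => ?_, rfl⟩
  rw [← h i hi]; apply hl'; rw [h i hi]; exact hi

lemma zface_sub_zero (t : Euc d) (z : ι → Euc d) (σ : ι → SignType) :
    zface t z σ ⊆ zface t z 0 := zface_mono fun i hi => absurd rfl hi

lemma face_iff (t : Euc d) (z : ι → Euc d) (F : Set (Euc d)) :
    (IsFace (zface t z 0) F ∧ F.Nonempty) ↔ ∃ c, F = zface t z (cov z c) := by
  constructor
  · rintro ⟨hF, hne⟩
    obtain ⟨l, rfl⟩ := hF hne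
    refine ⟨(InnerProductSpace.toDual ℝ (Euc d)).symm l, ?_⟩
    set c := (InnerProductSpace.toDual ℝ (Euc d)).symm l with hc
    have hlc : ∀ x, l x = ⟪c, x⟫_ℝ := fun x => by
      rw [hc, InnerProductSpace.toDual_symm_apply]
    apply Set.Subset.antisymm
    · rintro x ⟨⟨m, hm, hm', rfl⟩, hmax⟩
      refine ⟨m, hm, fun i hi => coeff_of_max t z c m hm ?_ i hi, rfl⟩
      intro y hy
      simpa only [hlc] using hmax y hy
    · intro x hx
      refine ⟨zface_sub_zero _ _ _ hx, fun y hy => ?_⟩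
      simpa only [hlc] using max_of_coeff t z c x hx y hy
  · rintro ⟨c, rfl⟩
    refine ⟨fun _ => ⟨InnerProductSpace.toDual ℝ (Euc d) c, ?_⟩, zface_nonempty _ _ _⟩
    apply Set.Subset.antisymm
    · intro x hx
      refine ⟨zface_sub_zero _ _ _ hx, fun y hy => ?_⟩
      simpa using max_of_coeff t z c x hx y hy
    · rintro x ⟨⟨m, hm, hm', rfl⟩, hmax⟩
      refine ⟨m, hm, fun i hi => coeff_of_max t z c m hm ?_ i hi, rfl⟩
      intro y hy
      simpa using hmax y hy

lemma zface_sub_iff (t : Euc d) (z : ι → Euc d) (σ : ι → SignType) (c : Euc d) :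
    zface t z σ ⊆ zface t z (cov z c) ↔ ∀ i, cov z c i ≠ 0 → σ i = cov z c i := by
  refine ⟨fun h i hi => ?_, zface_mono⟩
  have h1 : t + ∑ i, (σ i : ℝ) • z i ∈ zface t z σ :=
    ⟨_, fun i => abs_sign_le _, fun _ _ => rfl, rfl⟩
  have h2 := coeff_of_max t z c (fun i => (σ i : ℝ)) (fun i => abs_sign_le _)
    (fun y hy => max_of_coeff t z c _ (h h1) y hy) i hi
  generalize cov z c i = a at *
  generalize σ i = b at *
  cases a <;> cases b <;> first | rfl | (exfalso; norm_num at h2)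

lemma zface_inj (t : Euc d) (z : ι → Euc d) (c c' : Euc d)
    (h : zface t z (cov z c) = zface t z (cov z c')) : cov z c = cov z c' := by
  have h1 := (zface_sub_iff t z _ _).1 h.subset
  have h2 := (zface_sub_iff t z _ _).1 h.symm.subset
  funext i
  by_cases hi : cov z c' i = 0
  · by_contra hne
    have h3 : cov z c i ≠ 0 := by rw [hi] at hne; exact hne
    exact hne (h2 i h3).symm
  · exact h1 i hi

lemma vectorSpan_zface (t : Euc d) (z : ι → Euc d) (σ : ι → SignType) :
    vectorSpan ℝ (zface t z σ) = Submodule.span ℝ (z '' {i | σ i = 0}) := by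
  apply le_antisymm
  · rw [vectorSpan_def, Submodule.span_le]
    rintro _ ⟨x, ⟨l, hl, hl', rfl⟩, y, ⟨m, hm, hm', rfl⟩, rfl⟩
    simp only [vsub_eq_sub, add_sub_add_left_eq_sub, ← Finset.sum_sub_distrib, ← sub_smul]
    refine Submodule.sum_mem _ fun i _ => ?_
    by_cases hi : σ i = 0
    · exact Submodule.smul_mem _ _ (Submodule.subset_span ⟨i, hi, rfl⟩)
    · rw [hl' i hi, hm' i hi]; simp
  · rw [Submodule.span_le]
    rintro _ ⟨i, hi, rfl⟩
    have h1 : t + ∑ j, (σ j : ℝ) • z j ∈ zface t z σ :=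
      ⟨_, fun i => abs_sign_le _, fun _ _ => rfl, rfl⟩
    have h2 : t + ∑ j, (Function.update (fun j => (σ j : ℝ)) i 1 j) • z j ∈ zface t z σ := by
      refine ⟨_, fun j => ?_, fun j hj => ?_, rfl⟩
      · by_cases hji : j = i
        · subst hji; simp
        · rw [Function.update_of_ne hji]; exact abs_sign_le _
      · have : j ≠ i := by rintro rfl; exact hj hi
        rw [Function.update_of_ne this]
    have h3 := vsub_mem_vectorSpan ℝ h2 h1
    simp only [vsub_eq_sub, add_sub_add_left_eq_sub, ← Finset.sum_sub_distrib, ← sub_smul] at h3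
    rw [Finset.sum_eq_single i] at h3
    · have hi' : σ i = 0 := hi
      simpa [hi'] using h3
    · intro j _ hj
      rw [Function.update_of_ne hj]; simp
    · simp

/-- Membership of a generator in the span of a face. -/
lemma mem_flat_iff (z : ι → Euc d) (c : Euc d) (i : ι) :
    z i ∈ Submodule.span ℝ (z '' {i | cov z c i = 0}) ↔ cov z c i = 0 := by
  constructor
  · intro h
    have : Submodule.span ℝ (z '' {i | cov z c i = 0}) ≤ (Submodule.span ℝ {c})ᗮ := by
      rw [Submodule.span_le]
      rintro _ ⟨j, hj, rfl⟩
      rw [SetLike.mem_coe, Submodule.mem_orthogonal_singleton_iff_inner_right]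
      simpa [cov] using hj
    have h1 := this h
    rw [Submodule.mem_orthogonal_singleton_iff_inner_right] at h1
    simp [cov, h1]
  · intro h
    exact Submodule.subset_span ⟨i, h, rfl⟩

lemma cov_perp (z : ι → Euc d) (c : Euc d) :
    c ∈ (Submodule.span ℝ (z '' {i | cov z c i = 0}))ᗮ := by
  have : Submodule.span ℝ (z '' {i | cov z c i = 0}) ≤ (Submodule.span ℝ {c})ᗮ := by
      rw [Submodule.span_le]
      rintro _ ⟨j, hj, rfl⟩
      rw [SetLike.mem_coe, Submodule.mem_orthogonal_singleton_iff_inner_right]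
      simpa [cov] using hj
  have h2 := Submodule.orthogonal_le this
  rw [Submodule.orthogonal_orthogonal] at h2
  exact h2 (Submodule.mem_span_singleton_self c)

end GramAngles

set_option linter.unusedSectionVars false
namespace GramAngles
variable {d : ℕ} {ι : Type*} [Fintype ι] [DecidableEq ι]

lemma eq_sign_of_pos {s : SignType} {x : ℝ} (h : 0 < (s : ℝ) * x) : s = SignType.sign x := by
  cases s
  · simp at h
  · have : x < 0 := by simpa using h
    rw [sign_neg this]; rfl
  · have : 0 < x := by simpa using h
    rw [sign_pos this]; rfl

/-- Subspaces spanned by generators. -/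
def IsFl (z : ι → Euc d) (L : Submodule ℝ (Euc d)) : Prop :=
  L = Submodule.span ℝ (z '' {i | z i ∈ L})

open Classical in
/-- Generators in `N` but not in `L`. -/
def dset (z : ι → Euc d) (L N : Submodule ℝ (Euc d)) : Finset ι :=
  Finset.univ.filter fun i => z i ∈ N ∧ z i ∉ L

lemma mem_dset (z : ι → Euc d) (L N : Submodule ℝ (Euc d)) (i : ι) :
    i ∈ dset z L N ↔ z i ∈ N ∧ z i ∉ L := by simp [dset]

/-- Compose sign vectors. -/
def comb (τ ε : ι → SignType) : ι → SignType := fun i => if τ i = 0 then ε i else τ i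

lemma comb_cov (z : ι → Euc d) (c : Euc d) (L : Submodule ℝ (Euc d))
    (hL : IsFl z L) (N : Submodule ℝ (Euc d)) (hN : N = Submodule.span ℝ (z '' {i | cov z c i = 0}))
    (ε : ι → SignType) (hε : ε ∈ topes z (dset z L N) L) :
    ∃ c', comb (cov z c) ε = cov z c' := by
  classical
  obtain ⟨h0, c1, hc1, hreg⟩ := hε
  obtain ⟨s, hs, hs'⟩ := small_perturb (Finset.univ.filter fun i => cov z c i ≠ 0)
    (fun i => (cov z c i : ℝ) * ⟪c, z i⟫_ℝ) (fun i => (cov z c i : ℝ) * ⟪c1, z i⟫_ℝ) (by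
      intro i hi
      have hi' := (Finset.mem_filter.1 hi).2
      simp only [cov] at hi' ⊢
      rw [sign_mul_self]
      exact abs_pos.2 (by intro h; apply hi'; rw [h]; simp))
  refine ⟨c + s • c1, ?_⟩
  funext i
  simp only [comb]
  split_ifs with hi
  · have h1 : ⟪c, z i⟫_ℝ = 0 := by simpa [cov] using hi
    simp only [cov, inner_add_left, inner_smul_left, h1, zero_add]
    simp only [conj_trivial, sign_mul, sign_pos hs, one_mul]
    by_cases hiA : i ∈ dset z L N
    · exact eq_sign_of_pos (hreg i hiA)
    · rw [h0 i hiA]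
      have h2 : z i ∈ L := by
        by_contra hh
        apply hiA
        rw [mem_dset]
        exact ⟨hN ▸ (mem_flat_iff z c i).2 hi, hh⟩
      rw [Submodule.inner_left_of_mem_orthogonal h2 hc1]; simp
  · have h2 := hs' i (Finset.mem_filter.2 ⟨Finset.mem_univ _, hi⟩)
    apply eq_sign_of_pos
    rw [inner_add_left, inner_smul_left]
    simp only [conj_trivial]
    linarith

lemma faces_bij (t : Euc d) (z : ι → Euc d) (c : Euc d) (L : Submodule ℝ (Euc d))
    (hL : IsFl z L) (N : Submodule ℝ (Euc d)) (hN : N = Submodule.span ℝ (z '' {i | cov z c i = 0}))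
    (hLN : L ≤ N) :
    Set.BijOn (fun ε => zface t z (comb (cov z c) ε)) (topes z (dset z L N) L)
      {F | (IsFace (zface t z 0) F ∧ F.Nonempty) ∧ F ⊆ zface t z (cov z c) ∧
        vectorSpan ℝ F = L} := by
  have hτ : ∀ i, cov z c i = 0 ↔ z i ∈ N := fun i => by rw [hN, mem_flat_iff]
  have hz0 : ∀ ε ∈ topes z (dset z L N) L, ∀ i, ε i = 0 ↔ i ∉ dset z L N := by
    rintro ε ⟨h0, c1, hc1, hreg⟩ i
    refine ⟨fun h hi => ?_, h0 i⟩
    have := hreg i hi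
    simp [h] at this
  refine ⟨?_, ?_, ?_⟩
  · intro ε hε
    have hcomb := comb_cov z c L hL N hN ε hε
    refine ⟨?_, ?_, ?_⟩
    · obtain ⟨c', hc'⟩ := hcomb
      exact (face_iff _ _ _).2 ⟨c', congrArg (zface t z) hc'⟩
    · apply zface_mono
      intro i hi
      simp [comb, hi]
    · change vectorSpan ℝ (zface t z (comb (cov z c) ε)) = L
      rw [vectorSpan_zface]
      conv_rhs => rw [hL]
      congr 2
      ext i
      simp only [comb, Set.mem_ofPred_eq]
      constructor
      · intro h
        split_ifs at h with h1
        · have := (hz0 ε hε i).1 h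
          rw [mem_dset] at this
          by_contra hh
          exact this ⟨(hτ i).1 h1, hh⟩
        · exact absurd h h1
      · intro h
        rw [if_pos ((hτ i).2 (hLN h))]
        rw [hz0 ε hε i, mem_dset]
        exact fun hh => hh.2 h
  · intro ε hε ε' hε' heq
    obtain ⟨c1, h1⟩ := comb_cov z c L hL N hN ε hε
    obtain ⟨c2, h2⟩ := comb_cov z c L hL N hN ε' hε'
    simp only [h1, h2] at heq
    have h3 := zface_inj t z c1 c2 heq
    rw [← h1, ← h2] at h3
    funext i
    have h4 := congrFun h3 i
    simp only [comb] at h4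
    split_ifs at h4 with hi
    · exact h4
    · have : i ∉ dset z L N := by
        rw [mem_dset]; exact fun h => hi ((hτ i).2 h.1)
      rw [(hz0 ε hε i).2 this, (hz0 ε' hε' i).2 this]
  · rintro F ⟨hF, hFG, hFL⟩
    obtain ⟨c', rfl⟩ := (face_iff _ _ _).1 hF
    classical
    rw [vectorSpan_zface] at hFL
    have hσ : ∀ i, cov z c' i = 0 ↔ z i ∈ L := fun i => by rw [← hFL, mem_flat_iff]
    have hsub := (zface_sub_iff t z _ _).1 hFG
    refine ⟨fun i => if i ∈ dset z L N then cov z c' i else 0, ⟨?_, c', ?_, ?_⟩, ?_⟩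
    · intro i hi; simp [hi]
    · rw [← hFL]; exact cov_perp z c'
    · intro i hi
      simp only [hi, if_true]
      have : cov z c' i ≠ 0 := by rw [Ne, hσ]; exact ((mem_dset z L N i).1 hi).2
      simp only [cov] at this ⊢
      rw [sign_mul_self]
      exact abs_pos.2 (by intro h; apply this; rw [h]; simp)
    · change zface _ _ _ = zface _ _ _
      congr 1
      funext i
      simp only [comb]
      split_ifs with h1 h2
      · rfl
      · rw [eq_comm, hσ]
        rw [mem_dset] at h2
        by_contra hh
        exact h2 ⟨(hτ i).1 h1, hh⟩
      · exact (hsub i h1).symm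

lemma normalCone_eq (t : Euc d) (z : ι → Euc d) (σ τ : ι → SignType)
    (h : ∀ i, τ i ≠ 0 → σ i = τ i) :
    normalCone (zface t z σ) (zface t z τ) = {c | (∀ i, σ i = 0 → ⟪c, z i⟫_ℝ = 0) ∧
      ∀ i, τ i = 0 → 0 ≤ (σ i : ℝ) * ⟪c, z i⟫_ℝ} := by
  have hs0 : ∀ i, σ i = 0 → τ i = 0 := fun i hi => by
    by_contra hh; rw [h i hh] at hi; exact hh hi
  ext c
  constructor
  · intro hc
    have key : ∀ i, τ i = 0 → ∀ r : ℝ, |r| ≤ 1 → 0 ≤ ((σ i : ℝ) - r) * ⟪c, z i⟫_ℝ := by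
      intro i hi r hr
      have h1 : t + ∑ j, (σ j : ℝ) • z j ∈ zface t z σ :=
        ⟨_, fun i => abs_sign_le _, fun _ _ => rfl, rfl⟩
      have h2 : t + ∑ j, (Function.update (fun j => (σ j : ℝ)) i r j) • z j ∈ zface t z τ := by
        refine ⟨_, fun j => ?_, fun j hj => ?_, rfl⟩
        · by_cases hji : j = i
          · subst hji; simpa using hr
          · rw [Function.update_of_ne hji]; exact abs_sign_le _
        · have : j ≠ i := by rintro rfl; exact hj hi
          rw [Function.update_of_ne this, h j hj]
      have h3 := hc _ h1 _ h2
      rw [← sub_nonneg, ← inner_sub_right, add_sub_add_left_eq_sub, ← Finset.sum_sub_distrib] at h3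
      simp only [← sub_smul] at h3
      rw [Finset.sum_eq_single i] at h3
      · simpa [inner_smul_right] using h3
      · intro j _ hj
        rw [Function.update_of_ne hj]; simp
      · simp
    refine ⟨fun i hi => ?_, fun i hi => ?_⟩
    · have h1 := key i (hs0 i hi) 1 (by simp)
      have h2 := key i (hs0 i hi) (-1) (by simp)
      simp [hi] at h1 h2
      linarith
    · have h1 := key i hi 0 (by simp)
      simpa using h1
  · rintro ⟨h1, h2⟩ x ⟨l, hl, hl', rfl⟩ y ⟨m, hm, hm', rfl⟩
    simp only [inner_add_right, inner_sum, inner_smul_right]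
    refine add_le_add le_rfl (Finset.sum_le_sum fun j _ => ?_)
    by_cases hj : σ j = 0
    · simp [h1 j hj]
    · by_cases hj2 : τ j = 0
      · have h3 := h2 j hj2
        have h4 := hl' j hj
        have h5 := abs_le.1 (hm j)
        rw [h4]
        rcases sign_ne_zero' hj with h | h <;> rw [h] at h3 ⊢ <;> simp at h3 ⊢ <;> nlinarith
      · rw [hl' j hj, hm' j hj2, h j hj2]

lemma outerCone_eq (t : Euc d) (z : ι → Euc d) (c c' : Euc d) (L N : Submodule ℝ (Euc d))
    (hN : N = Submodule.span ℝ (z '' {i | cov z c i = 0}))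
    (hL : L = Submodule.span ℝ (z '' {i | cov z c' i = 0}))
    (h : ∀ i, cov z c i ≠ 0 → cov z c' i = cov z c i) :
    outerCone (zface t z (cov z c')) (zface t z (cov z c)) =
      ocone (fun i => Lᗮ.starProjection (z i)) (dset z L N) (cov z c') := by
  have hτ : ∀ i, cov z c i = 0 ↔ z i ∈ N := fun i => by rw [hN, mem_flat_iff]
  have hσ : ∀ i, cov z c' i = 0 ↔ z i ∈ L := fun i => by rw [hL, mem_flat_iff]
  have hin : ∀ x i, ⟪x, Lᗮ.starProjection (z i)⟫_ℝ = ⟪Lᗮ.starProjection x, z i⟫_ℝ := by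
    intro x i
    exact (Submodule.inner_starProjection_left_eq_right _ _ _).symm
  rw [outerCone, normalCone_eq t z _ _ h, vectorSpan_zface, ← hL]
  ext x
  simp only [ocone, Set.mem_add, Set.mem_ofPred_eq, SetLike.mem_coe, hin]
  constructor
  · rintro ⟨y, ⟨h1, h2⟩, w, hw, rfl⟩ i hi
    have hy : y ∈ Lᗮ := by
      rw [hL, Submodule.mem_orthogonal']
      intro u hu
      induction hu using Submodule.span_induction with
      | mem u hu => obtain ⟨i, hi, rfl⟩ := hu; exact h1 i hi
      | zero => simp
      | add a b _ _ ha hb => rw [inner_add_right, ha, hb, add_zero]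
      | smul r a _ ha => rw [inner_smul_right, ha, mul_zero]
    have hw' : Lᗮ.starProjection w = 0 := by
      rw [Submodule.starProjection_apply_eq_zero_iff]
      simpa using hw
    rw [map_add, hw', add_zero, Submodule.starProjection_eq_self_iff.2 hy]
    exact h2 i ((hτ i).2 ((mem_dset z L N i).1 hi).1)
  · intro hx
    refine ⟨Lᗮ.starProjection x, ⟨fun i hi => ?_, fun i hi => ?_⟩, x - Lᗮ.starProjection x, ?_, by simp⟩
    · exact Submodule.inner_left_of_mem_orthogonal ((hσ i).1 hi)
        (Submodule.starProjection_apply_mem _ _)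
    · by_cases h2 : cov z c' i = 0
      · simp [h2]
      · exact hx i ((mem_dset z L N i).2 ⟨(hτ i).1 hi, fun hh => h2 ((hσ i).2 hh)⟩)
    · have := Submodule.sub_starProjection_mem_orthogonal (K := Lᗮ) x
      rwa [Submodule.orthogonal_orthogonal] at this

end GramAngles

set_option linter.unusedSectionVars false
namespace GramAngles
variable {d : ℕ} {ι : Type*} [Fintype ι] [DecidableEq ι]

lemma posHull_add {G : Set (Euc d)} (hG : Convex ℝ G) (q : Euc d) {u v : Euc d}
    (hu : u ∈ posHull ((fun x => x - q) '' G)) (hv : v ∈ posHull ((fun x => x - q) '' G)) :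
    u + v ∈ posHull ((fun x => x - q) '' G) := by
  obtain ⟨a, _, ⟨x, hx, rfl⟩, ha, rfl⟩ := hu
  obtain ⟨b, _, ⟨y, hy, rfl⟩, hb, rfl⟩ := hv
  by_cases hab : a + b = 0
  · have ha0 : a = 0 := by linarith
    have hb0 : b = 0 := by linarith
    subst ha0; subst hb0
    exact ⟨0, _, ⟨x, hx, rfl⟩, le_rfl, by simp⟩
  · have hpos : 0 < a + b := lt_of_le_of_ne (by linarith) (Ne.symm hab)
    refine ⟨a + b, _, ⟨(a / (a + b)) • x + (b / (a + b)) • y,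
      hG hx hy (by positivity) (by positivity) (by field_simp), rfl⟩, hpos.le, ?_⟩
    simp only [smul_sub, smul_add, smul_smul]
    rw [mul_div_cancel₀ _ hab, mul_div_cancel₀ _ hab, add_smul]
    abel

/-- The inner cone as a pointed cone. -/
def innerPC (F G : Set (Euc d)) (hG : Convex ℝ G) (hne : G.Nonempty) : PointedCone ℝ (Euc d) where
  carrier := innerCone F G
  add_mem' := by
    rintro _ _ ⟨u, hu, n, hn, rfl⟩ ⟨v, hv, m, hm, rfl⟩
    exact ⟨u + v, posHull_add hG _ hu hv, n + m, Submodule.add_mem _ hn hm, by simp only []; abel⟩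
  zero_mem' := by
    obtain ⟨x, hx⟩ := hne
    exact ⟨0, ⟨0, _, ⟨x, hx, rfl⟩, le_rfl, by simp⟩, 0, Submodule.zero_mem _, by simp⟩
  smul_mem' := by
    rintro r _ ⟨u, ⟨a, p, hp, ha, rfl⟩, n, hn, rfl⟩
    refine ⟨(r : ℝ) • a • p, ⟨r * a, p, hp, mul_nonneg r.2 ha, by rw [mul_smul]⟩, (r : ℝ) • n,
      Submodule.smul_mem _ _ hn, ?_⟩
    simp only []
    rw [← smul_add]; rfl

lemma relPt_mem {F : Set (Euc d)} (hF : Convex ℝ F) (hne : F.Nonempty) :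
    relPt F ∈ intrinsicInterior ℝ F := by
  have h := hne.intrinsicInterior hF
  rw [relPt, dif_pos h]
  exact h.some_mem

lemma relPt_move {F : Set (Euc d)} (hF : Convex ℝ F) (hne : F.Nonempty) {w : Euc d}
    (hw : w ∈ vectorSpan ℝ F) : ∃ s : ℝ, 0 < s ∧ relPt F + s • w ∈ F := by
  obtain ⟨y, hy, hyq⟩ := mem_intrinsicInterior.1 (relPt_mem hF hne)
  have hmem : ∀ s : ℝ, relPt F + s • w ∈ affineSpan ℝ F := by
    intro s
    have := AffineSubspace.vadd_mem_of_mem_direction (s := affineSpan ℝ F) (v := s • w) (p := (y : Euc d))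
      (by rw [direction_affineSpan]; exact Submodule.smul_mem _ _ hw) y.2
    rw [← hyq, add_comm]; exact this
  let f : ℝ → affineSpan ℝ F := fun s => ⟨relPt F + s • w, hmem s⟩
  have hf : Continuous f := by
    apply Continuous.subtype_mk
    fun_prop
  have hf0 : f 0 = y := by
    apply Subtype.ext; simp [f, hyq]
  have hev : ∀ᶠ s in nhds (0 : ℝ), f s ∈ ((↑) ⁻¹' F : Set (affineSpan ℝ F)) := by
    apply hf.continuousAt.eventually_mem
    rw [hf0]
    exact mem_interior_iff_mem_nhds.1 hy
  obtain ⟨ε, hε, hball⟩ := Metric.eventually_nhds_iff.1 hev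
  refine ⟨ε / 2, by positivity, ?_⟩
  have := hball (y := ε / 2) (by rw [Real.dist_eq, sub_zero, abs_of_pos (by positivity)]; linarith)
  exact this

lemma innerCone_eq (t : Euc d) (z : ι → Euc d) (c c' : Euc d) (L N : Submodule ℝ (Euc d))
    (hN : N = Submodule.span ℝ (z '' {i | cov z c i = 0}))
    (hL : L = Submodule.span ℝ (z '' {i | cov z c' i = 0}))
    (h : ∀ i, cov z c i ≠ 0 → cov z c' i = cov z c i) :
    innerCone (zface t z (cov z c')) (zface t z (cov z c)) =
      (tcone z (dset z L N) (L ⊔ Nᗮ) (cov z c') : Set (Euc d)) := by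
  have hτ : ∀ i, cov z c i = 0 ↔ z i ∈ N := fun i => by rw [hN, mem_flat_iff]
  have hσ : ∀ i, cov z c' i = 0 ↔ z i ∈ L := fun i => by rw [hL, mem_flat_iff]
  set F := zface t z (cov z c') with hF
  set G := zface t z (cov z c) with hG
  have hFG : F ⊆ G := zface_mono h
  have hFc : Convex ℝ F := zface_convex _ _ _
  have hGc : Convex ℝ G := zface_convex _ _ _
  have hFn : F.Nonempty := zface_nonempty _ _ _
  have hq : relPt F ∈ F := intrinsicInterior_subset (relPt_mem hFc hFn)
  have hVG : vectorSpan ℝ G = N := by rw [hG, vectorSpan_zface, hN]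
  have hVF : vectorSpan ℝ F = L := by rw [hF, vectorSpan_zface, hL]
  apply Set.Subset.antisymm
  · rintro _ ⟨_, ⟨a, _, ⟨y, hy, rfl⟩, ha, rfl⟩, n, hn, rfl⟩
    rw [hVG] at hn
    have hW : ∀ w ∈ L ⊔ Nᗮ, w ∈ tcone z (dset z L N) (L ⊔ Nᗮ) (cov z c') := fun w hw =>
      (le_sup_left : PointedCone.ofSubmodule (L ⊔ Nᗮ) ≤ tcone z _ _ _) hw
    refine Submodule.add_mem _ ?_ (hW n (Submodule.mem_sup_right hn))
    have : y - relPt F ∈ tcone z (dset z L N) (L ⊔ Nᗮ) (cov z c') := by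
      generalize relPt F = q at hq
      obtain ⟨l, hl, hl', rfl⟩ := hq
      obtain ⟨m, hm, hm', rfl⟩ := hy
      rw [add_sub_add_left_eq_sub, ← Finset.sum_sub_distrib]
      refine Submodule.sum_mem _ fun i _ => ?_
      rw [← sub_smul]
      by_cases hi : cov z c' i = 0
      · exact hW _ (Submodule.mem_sup_left (Submodule.smul_mem _ _ ((hσ i).1 hi)))
      · by_cases hi2 : cov z c i = 0
        · have hiA : i ∈ dset z L N := (mem_dset z L N i).2
            ⟨(hτ i).1 hi2, fun hh => hi ((hσ i).2 hh)⟩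
          have hg : -((cov z c' i : ℝ) • z i) ∈ tcone z (dset z L N) (L ⊔ Nᗮ) (cov z c') :=
            (le_sup_right : PointedCone.hull ℝ _ ≤ tcone z _ _ _)
              (Submodule.subset_span ⟨i, hiA, rfl⟩)
          have h5 := abs_le.1 (hm i)
          have hco : 0 ≤ 1 - m i * (cov z c' i : ℝ) := by
            rcases sign_ne_zero' hi with h | h <;> rw [h] <;> simp <;> linarith
          have := Submodule.smul_mem _ (⟨_, hco⟩ : {r : ℝ // 0 ≤ r}) hg
          convert this using 1
          change _ = (1 - m i * (cov z c' i : ℝ)) • -((cov z c' i : ℝ) • z i)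
          rw [hl' i hi, smul_neg, smul_smul, ← neg_smul]
          congr 1
          rcases sign_ne_zero' hi with h | h <;> rw [h] <;> simp [add_comm]
        · rw [hm' i hi2, hl' i hi, h i hi2]; simp
    exact Submodule.smul_mem _ (⟨a, ha⟩ : {r : ℝ // 0 ≤ r}) this
  · have hle : tcone z (dset z L N) (L ⊔ Nᗮ) (cov z c') ≤ innerPC F G hGc (hFn.mono hFG) := by
      refine sup_le ?_ ?_
      · intro w hw
        have hw' : w ∈ L ⊔ Nᗮ := hw
        obtain ⟨u, hu, n, hn, rfl⟩ := Submodule.mem_sup.1 hw'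
        refine ⟨u, ?_, n, by rw [hVG]; exact hn, rfl⟩
        obtain ⟨s, hs, hs'⟩ := relPt_move hFc hFn (w := u) (by rw [hVF]; exact hu)
        refine ⟨s⁻¹, _, ⟨_, hFG hs', rfl⟩, by positivity, ?_⟩
        simp [smul_smul, hs.ne']
      · refine Submodule.span_le.2 ?_
        rintro _ ⟨i, hi, rfl⟩
        have hi' := (mem_dset z L N i).1 hi
        refine ⟨_, ⟨1, _, ⟨relPt F - (cov z c' i : ℝ) • z i, ?_, rfl⟩, zero_le_one, ?_⟩, 0,
          Submodule.zero_mem _, add_zero _⟩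
        · generalize relPt F = q at hq
          obtain ⟨l, hl, hl', rfl⟩ := hq
          have hlt : cov z c' i ≠ 0 := fun hh => hi'.2 ((hσ i).1 hh)
          refine ⟨fun j => if j = i then 0 else l j, fun j => ?_, fun j hj => ?_, ?_⟩
          · simp only []
            split_ifs
            · simp
            · exact hl j
          · have hji : j ≠ i := by rintro rfl; exact hj ((hτ j).2 hi'.1)
            simp only [hji, if_false]
            rw [← h j hj]; apply hl'; rw [h j hj]; exact hj
          · rw [add_sub_assoc, ← hl' i hlt, sub_eq_iff_eq_add.2]
            have e1 := Finset.sum_erase_add Finset.univ (fun j => l j • z j) (Finset.mem_univ i)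
            have e2 := Finset.sum_erase_add Finset.univ
              (fun j => (if j = i then (0 : ℝ) else l j) • z j) (Finset.mem_univ i)
            rw [← e1, ← e2]
            simp only [if_true, zero_smul, add_zero]
            congr 1
            refine Finset.sum_congr rfl fun j hj => ?_
            simp [Finset.ne_of_mem_erase hj]
        · simp
    exact hle

lemma topes_sup (z : ι → Euc d) (L N : Submodule ℝ (Euc d)) (hLN : L ≤ N) :
    topes z (dset z L N) L = topes z (dset z L N) (L ⊔ Nᗮ) := by
  ext ε
  refine and_congr_right fun _ => ?_
  constructor
  · rintro ⟨c, hc, hreg⟩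
    refine ⟨N.starProjection c, ?_, fun i hi => ?_⟩
    · rw [Submodule.mem_orthogonal']
      intro u hu
      obtain ⟨a, ha, n, hn, rfl⟩ := Submodule.mem_sup.1 hu
      rw [inner_add_right, Submodule.inner_starProjection_left_eq_right,
        Submodule.starProjection_eq_self_iff.2 (hLN ha),
        Submodule.inner_left_of_mem_orthogonal ha hc,
        Submodule.inner_right_of_mem_orthogonal (Submodule.starProjection_apply_mem _ _) hn, add_zero]
    · rw [Submodule.inner_starProjection_left_eq_right,
        Submodule.starProjection_eq_self_iff.2 ((mem_dset z L N i).1 hi).1]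
      exact hreg i hi
  · rintro ⟨c, hc, hreg⟩
    exact ⟨c, Submodule.orthogonal_le le_sup_left hc, hreg⟩

end GramAngles

set_option linter.unusedSectionVars false
namespace GramAngles
variable {d : ℕ} {ι : Type*} [Fintype ι] [DecidableEq ι]

/-- Faces below a given face with prescribed linear span. -/
def facesUnder (Z G : Set (Euc d)) (L : Submodule ℝ (Euc d)) : Set (Set (Euc d)) :=
  {F | (IsFace Z F ∧ F.Nonempty) ∧ F ⊆ G ∧ vectorSpan ℝ F = L}

lemma ocone_congr (a : ι → Euc d) (A : Finset ι) {ε ε' : ι → SignType}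
    (h : ∀ i ∈ A, ε i = ε' i) : ocone a A ε = ocone a A ε' := by
  ext x
  simp only [ocone, Set.mem_ofPred_eq]
  refine forall₂_congr fun i hi => ?_
  rw [h i hi]

lemma tcone_congr (z : ι → Euc d) (A : Finset ι) (W : Submodule ℝ (Euc d)) {ε ε' : ι → SignType}
    (h : ∀ i ∈ A, ε i = ε' i) : tcone z A W ε = tcone z A W ε' := by
  unfold tcone
  congr 2
  refine Set.image_congr fun i hi => ?_
  rw [h i hi]

lemma ext_sum (α : ConeAngle d) (t : Euc d) (z : ι → Euc d) (c : Euc d) (L : Submodule ℝ (Euc d))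
    (hL : IsFl z L) (N : Submodule ℝ (Euc d)) (hN : N = Submodule.span ℝ (z '' {i | cov z c i = 0}))
    (hLN : L ≤ N) :
    ∑ᶠ F ∈ facesUnder (zface t z 0) (zface t z (cov z c)) L, extAngle α F (zface t z (cov z c)) = 1 := by
  classical
  have hτ : ∀ i, cov z c i = 0 ↔ z i ∈ N := fun i => by rw [hN, mem_flat_iff]
  rw [← sum_topes_ocone α z (dset z L N) L (fun i hi => ((mem_dset z L N i).1 hi).2)]
  unfold facesUnder
  rw [← finsum_mem_eq_of_bijOn (f := fun ε => extAngle α (zface t z (comb (cov z c) ε)) (zface t z (cov z c)))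
    _ (faces_bij t z c L hL N hN hLN) (fun _ _ => rfl)]
  rw [← finsum_mem_finset_eq_sum]
  refine finsum_mem_congr ?_ ?_
  · ext; simp
  · intro ε hε
    replace hε : ε ∈ topes z (dset z L N) L := by simpa using hε
    obtain ⟨c', hc'⟩ := comb_cov z c L hL N hN ε hε
    have hspan := (faces_bij t z c L hL N hN hLN).mapsTo hε
    have hspan := hspan.2.2
    change vectorSpan ℝ (zface t z (comb (cov z c) ε)) = L at hspan
    rw [hc', vectorSpan_zface] at hspan
    rw [hc', extAngle, outerCone_eq t z c c' L N hN hspan.symm]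
    · congr 1
      apply ocone_congr
      intro i hi
      rw [← hc', comb, if_pos ((hτ i).2 ((mem_dset z L N i).1 hi).1)]
    · intro i hi
      rw [← hc', comb, if_neg hi]

open Classical in
/-- Candidate Möbius values, by crosscuts. -/
def vmob (z : ι → Euc d) (L N : Submodule ℝ (Euc d)) : ℝ :=
  ∑ B ∈ (dset z L ⊤).powerset, (-1 : ℝ) ^ B.card *
    (if L ⊔ Submodule.span ℝ (z '' (B : Set ι)) = N then 1 else 0)

lemma sup_perp_eq_top {M N : Submodule ℝ (Euc d)} (h : M ≤ N) : M ⊔ Nᗮ = ⊤ ↔ M = N := by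
  constructor
  · intro ht
    refine le_antisymm h fun x hx => ?_
    have : x ∈ M ⊔ Nᗮ := ht ▸ Submodule.mem_top
    obtain ⟨m, hm, n, hn, rfl⟩ := Submodule.mem_sup.1 this
    have hn' : n ∈ N := by
      have := Submodule.sub_mem _ hx (h hm)
      simpa using this
    have : n = 0 := by
      have := Submodule.inner_right_of_mem_orthogonal hn' hn
      exact inner_self_eq_zero.1 this
    simpa [this] using hm
  · rintro rfl
    exact Submodule.sup_orthogonal_of_hasOrthogonalProjection

lemma codim_eq {L N : Submodule ℝ (Euc d)} (h : L ≤ N) :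
    d - Module.finrank ℝ (L ⊔ Nᗮ : Submodule ℝ (Euc d)) = Module.finrank ℝ N - Module.finrank ℝ L := by
  have h1 := Submodule.finrank_sup_add_finrank_inf_eq L Nᗮ
  have h2 : L ⊓ Nᗮ = ⊥ := by
    rw [eq_bot_iff, ← N.inf_orthogonal_eq_bot]
    exact inf_le_inf_right _ h
  have h3 := Submodule.finrank_add_finrank_orthogonal N
  rw [h2, finrank_bot] at h1
  rw [finrank_euclideanSpace, Fintype.card_fin] at h3
  have := Submodule.finrank_mono h
  omega

lemma fsum_eq_vmob (α : ConeAngle d) (z : ι → Euc d) (L N : Submodule ℝ (Euc d)) (hLN : L ≤ N) :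
    fsum α z (dset z L N) (L ⊔ Nᗮ) =
      (-1 : ℝ) ^ (Module.finrank ℝ N - Module.finrank ℝ L) * vmob z L N := by
  classical
  have h1 := fsum_closed α z (dset z L N) (L ⊔ Nᗮ)
  rw [codim_eq hLN] at h1
  have h2 : vmob z L N = ∑ B ∈ (dset z L N).powerset, (-1 : ℝ) ^ B.card *
        (if (L ⊔ Nᗮ) ⊔ Submodule.span ℝ (z '' (B : Set ι)) = ⊤ then 1 else 0) := by
    rw [vmob]
    symm
    have hsub : (dset z L N).powerset ⊆ (dset z L ⊤).powerset := by
      apply Finset.powerset_mono.2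
      intro i hi
      rw [mem_dset] at hi ⊢
      exact ⟨trivial, hi.2⟩
    rw [← Finset.sum_subset hsub]
    · refine Finset.sum_congr rfl fun B hB => ?_
      rw [Finset.mem_powerset] at hB
      congr 2
      rw [sup_right_comm, sup_perp_eq_top]
      refine sup_le hLN (Submodule.span_le.2 ?_)
      rintro _ ⟨i, hi, rfl⟩
      exact ((mem_dset z L N i).1 (hB hi)).1
    · intro B hB hB'
      rw [if_neg, mul_zero]
      intro hN
      apply hB'
      rw [Finset.mem_powerset] at hB ⊢
      intro i hi
      rw [mem_dset]
      refine ⟨?_, ((mem_dset z L ⊤ i).1 (hB hi)).2⟩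
      rw [← hN]
      exact Submodule.mem_sup_right (Submodule.subset_span ⟨i, hi, rfl⟩)
  rw [h2, ← h1, ← mul_assoc, ← mul_pow]
  simp

lemma int_sum (α : ConeAngle d) (t : Euc d) (z : ι → Euc d) (c : Euc d) (L : Submodule ℝ (Euc d))
    (hL : IsFl z L) (N : Submodule ℝ (Euc d)) (hN : N = Submodule.span ℝ (z '' {i | cov z c i = 0}))
    (hLN : L ≤ N) :
    ∑ᶠ F ∈ facesUnder (zface t z 0) (zface t z (cov z c)) L, intAngle α F (zface t z (cov z c)) =
      (-1 : ℝ) ^ (Module.finrank ℝ N - Module.finrank ℝ L) * vmob z L N := by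
  classical
  have hτ : ∀ i, cov z c i = 0 ↔ z i ∈ N := fun i => by rw [hN, mem_flat_iff]
  rw [← fsum_eq_vmob α z L N hLN, fsum]
  unfold facesUnder
  rw [← finsum_mem_eq_of_bijOn (f := fun ε => intAngle α (zface t z (comb (cov z c) ε)) (zface t z (cov z c)))
    _ (faces_bij t z c L hL N hN hLN) (fun _ _ => rfl)]
  rw [← finsum_mem_finset_eq_sum]
  refine finsum_mem_congr ?_ ?_
  · ext; simp [topes_sup z L N hLN]
  · intro ε hε
    replace hε : ε ∈ topes z (dset z L N) L := by simpa [topes_sup z L N hLN] using hε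
    obtain ⟨c', hc'⟩ := comb_cov z c L hL N hN ε hε
    have hspan := (faces_bij t z c L hL N hN hLN).mapsTo hε
    have hspan := hspan.2.2
    change vectorSpan ℝ (zface t z (comb (cov z c) ε)) = L at hspan
    rw [hc', vectorSpan_zface] at hspan
    rw [hc', intAngle, innerCone_eq t z c c' L N hN hspan.symm]
    · congr 2
      apply tcone_congr
      intro i hi
      rw [← hc', comb, if_pos ((hτ i).2 ((mem_dset z L N i).1 hi).1)]
    · intro i hi
      rw [← hc', comb, if_neg hi]

/-- Flats are exactly the subspaces spanned by generators. -/
lemma mem_Flats_iff (t : Euc d) (z : ι → Euc d) (L : Submodule ℝ (Euc d)) :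
    L ∈ Flats (zface t z 0) ↔ IsFl z L := by
  constructor
  · rintro ⟨F, h1, h2, rfl⟩
    obtain ⟨c, rfl⟩ := (face_iff _ _ _).1 ⟨h1, h2⟩
    rw [vectorSpan_zface, IsFl]
    congr 2
    ext i
    simp only [Set.mem_ofPred_eq]
    rw [mem_flat_iff]
  · intro hL
    -- a generic covector vanishing exactly on the generators in `L`
    have hc0 : cov z (0 : Euc d) = 0 := by funext i; simp [cov]
    have hLN : L ≤ Submodule.span ℝ (z '' {i | cov z (0 : Euc d) i = 0}) := by
      rw [hL]
      apply Submodule.span_mono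
      apply Set.image_mono
      intro i _
      simp [hc0]
    have hne : (topes z (dset z L (Submodule.span ℝ (z '' {i | cov z (0 : Euc d) i = 0}))) L).Nonempty := by
      by_contra hemp
      rw [Set.not_nonempty_iff_eq_empty] at hemp
      set A := dset z L (Submodule.span ℝ (z '' {i | cov z (0 : Euc d) i = 0}))
      classical
      have key : ∃ c ∈ Lᗮ, ∀ i ∈ A, ⟪c, z i⟫_ℝ ≠ 0 := by
        have hA : ∀ i ∈ A, z i ∉ L := fun i hi => ((mem_dset _ _ _ _).1 hi).2
        clear hemp
        clear_value A
        induction A using Finset.induction_on with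
        | empty => exact ⟨0, Submodule.zero_mem _, by simp⟩
        | insert b A hb ih =>
          obtain ⟨c, hc, hcA⟩ := ih fun i hi => hA i (Finset.mem_insert_of_mem hi)
          obtain ⟨w, hw, hwb⟩ := exists_perp (hA b (Finset.mem_insert_self _ _))
          by_cases hcb : ⟪c, z b⟫_ℝ = 0
          · obtain ⟨s, hs, hs'⟩ := small_perturb A (fun i => ⟪c, z i⟫_ℝ * ⟪c, z i⟫_ℝ)
              (fun i => ⟪c, z i⟫_ℝ * ⟪w, z i⟫_ℝ) (fun i hi => mul_self_pos.2 (hcA i hi))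
            refine ⟨c + s • w, Submodule.add_mem _ hc (Submodule.smul_mem _ _ hw), fun i hi => ?_⟩
            rw [inner_add_left, inner_smul_left]
            simp only [conj_trivial]
            rcases Finset.mem_insert.1 hi with rfl | hi
            · rw [hcb, zero_add]; exact (mul_pos hs hwb).ne'
            · intro h0
              have := hs' i hi
              have e : ⟪c, z i⟫_ℝ * ⟪c, z i⟫_ℝ + s * (⟪c, z i⟫_ℝ * ⟪w, z i⟫_ℝ) =
                ⟪c, z i⟫_ℝ * (⟪c, z i⟫_ℝ + s * ⟪w, z i⟫_ℝ) := by ring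
              rw [e, h0, mul_zero] at this
              exact lt_irrefl _ this
          · refine ⟨c, hc, fun i hi => ?_⟩
            rcases Finset.mem_insert.1 hi with rfl | hi
            · exact hcb
            · exact hcA i hi
      obtain ⟨c, hc, hcA⟩ := key
      have : (fun i => if i ∈ A then cov z c i else 0) ∈ topes z A L := by
        refine ⟨fun i hi => by simp [hi], c, hc, fun i hi => ?_⟩
        simp only [hi, if_true, cov]
        rw [sign_mul_self]
        exact abs_pos.2 (hcA i hi)
      rw [hemp] at this
      exact this
    obtain ⟨ε, hε⟩ := hne
    have := (faces_bij t z 0 L hL _ rfl hLN).mapsTo hε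
    exact ⟨_, this.1.1, this.1.2, this.2.2.symm⟩

end GramAngles

set_option linter.unusedSectionVars false
namespace GramAngles

section mob
variable {β : Type*} [PartialOrder β]

lemma chain_nodup {l : List β} (h : l.IsChain (· < ·)) : l.Nodup :=
  (List.isChain_iff_pairwise.1 h).imp (fun h => ne_of_lt h)

lemma chains_finite [Finite β] : {l : List β | l.IsChain (· < ·)}.Finite := by
  classical
  have := Fintype.ofFinite β
  have h : {l : List β | l.Nodup}.Finite := by
    have : Finite {l : List β // l.Nodup} := inferInstance
    exact Set.finite_coe_iff.1 this
  exact h.subset fun l hl => chain_nodup hl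

lemma chainsFromTo_finite [Finite β] (a c : β) : (chainsFromTo a c).Finite :=
  chains_finite.subset fun _ hl => hl.1

lemma le_of_chainsFromTo {a c : β} {l : List β} (h : l ∈ chainsFromTo a c) : a ≤ c := by
  obtain ⟨h1, h2, h3⟩ := h
  rcases l with _ | ⟨b, l⟩
  · simp at h2
  · simp at h2
    subst h2
    have h1' := List.isChain_iff_pairwise.1 h1
    rw [List.getLast?_eq_getLast_of_ne_nil (by simp)] at h3
    have hc : (b :: l).getLast (by simp) = c := by simpa using h3
    have hm : c ∈ b :: l := hc ▸ List.getLast_mem _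
    rcases List.mem_cons.1 hm with h | h
    · exact h.ge
    · exact (List.rel_of_pairwise_cons h1' h).le

lemma mob_of_not_le {a c : β} (h : ¬ a ≤ c) : mob a c = 0 := by
  rw [mob]
  have : chainsFromTo a c = ∅ := by
    rw [Set.eq_empty_iff_forall_notMem]
    exact fun l hl => h (le_of_chainsFromTo hl)
  rw [this, finsum_mem_empty]

lemma mob_self (c : β) : mob c c = 1 := by
  have : chainsFromTo c c = {[c]} := by
    ext l
    simp only [Set.mem_singleton_iff]
    constructor
    · rintro ⟨h1, h2, h3⟩
      rcases l with _ | ⟨b, _ | ⟨b', l⟩⟩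
      · simp at h2
      · simpa using h2
      · exfalso
        simp at h2
        subst h2
        have h4 : b < b' := (List.isChain_cons_cons.1 h1).1
        have h5 : b' ≤ b := le_of_chainsFromTo (l := b' :: l)
          ⟨(List.isChain_cons_cons.1 h1).2, rfl, by simpa using h3⟩
        exact absurd h4 (not_lt_of_ge h5)
    · rintro rfl
      exact ⟨List.isChain_singleton _, rfl, rfl⟩
  rw [mob, this, finsum_mem_singleton]
  norm_num

lemma chainsFromTo_eq {a c : β} (hac : a ≠ c) :
    chainsFromTo a c = ⋃ b ∈ {b : β | a < b}, (List.cons a) '' chainsFromTo b c := by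
  ext l
  simp only [Set.mem_iUnion, Set.mem_image, exists_prop, Set.mem_ofPred_eq]
  constructor
  · rintro ⟨h1, h2, h3⟩
    rcases l with _ | ⟨b, _ | ⟨b', l⟩⟩
    · simp at h2
    · simp at h2 h3
      exact absurd (h2.symm.trans h3) hac
    · simp at h2
      subst h2
      exact ⟨b', (List.isChain_cons_cons.1 h1).1, b' :: l,
        ⟨(List.isChain_cons_cons.1 h1).2, rfl, by simpa using h3⟩, rfl⟩
  · rintro ⟨b, hab, l, ⟨h1, h2, h3⟩, rfl⟩
    rcases l with _ | ⟨b', l⟩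
    · simp at h2
    · simp at h2
      subst h2
      exact ⟨List.isChain_cons_cons.2 ⟨hab, h1⟩, rfl, by simpa using h3⟩

open Classical in
lemma mob_rec [Fintype β] {a c : β} (hac : a ≠ c) :
    mob a c = - ∑ b ∈ Finset.univ.filter (a < ·), mob b c := by
  rw [mob, chainsFromTo_eq hac, finsum_mem_biUnion]
  · rw [← Finset.sum_neg_distrib, ← finsum_mem_finset_eq_sum]
    refine finsum_mem_congr (by ext; simp) fun b _ => ?_
    rw [finsum_mem_image (by simp), mob, ← finsum_mem_neg_distrib _ (chainsFromTo_finite b c)]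
    refine finsum_mem_congr rfl fun l _ => ?_
    rw [List.length_cons, pow_succ]; ring
  · intro b _ b' _ hbb'
    rw [Function.onFun, Set.disjoint_left]
    rintro _ ⟨l, hl, rfl⟩ ⟨l', hl', h⟩
    have : l' = l := by simpa using h
    subst this
    apply hbb'
    have := hl.2.1.symm.trans hl'.2.1
    simpa using this
  · exact Set.toFinite _
  · intro b _
    exact (chainsFromTo_finite b c).image _

end mob

variable {d : ℕ} {ι : Type*} [Fintype ι] [DecidableEq ι]

lemma finite_isFl (z : ι → Euc d) : {L | IsFl z L}.Finite := by
  refine (Set.finite_range fun s : Set ι => Submodule.span ℝ (z '' s)).subset ?_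
  intro L hL
  exact ⟨{i | z i ∈ L}, hL.symm⟩

lemma isFl_sup (z : ι → Euc d) {L : Submodule ℝ (Euc d)} (hL : IsFl z L) (B : Set ι) :
    IsFl z (L ⊔ Submodule.span ℝ (z '' B)) := by
  apply le_antisymm
  · refine sup_le ?_ ?_
    · conv_lhs => rw [hL]
      apply Submodule.span_mono
      apply Set.image_mono
      intro i hi
      exact Submodule.mem_sup_left hi
    · apply Submodule.span_mono
      apply Set.image_mono
      intro i hi
      exact Submodule.mem_sup_right (Submodule.subset_span ⟨i, hi, rfl⟩)
  · rw [Submodule.span_le]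
    rintro _ ⟨i, hi, rfl⟩
    exact hi

lemma vmob_self (z : ι → Euc d) (L : Submodule ℝ (Euc d)) : vmob z L L = 1 := by
  classical
  rw [vmob, Finset.sum_eq_single ∅]
  · simp
  · intro B hB hB0
    rw [if_neg, mul_zero]
    intro h
    obtain ⟨i, hi⟩ := Finset.nonempty_iff_ne_empty.2 hB0
    apply ((mem_dset z L ⊤ i).1 (Finset.mem_powerset.1 hB hi)).2
    rw [← h]
    exact Submodule.mem_sup_right (Submodule.subset_span ⟨i, hi, rfl⟩)
  · simp

lemma vmob_sum (z : ι → Euc d) (T : Finset (Submodule ℝ (Euc d))) (L N : Submodule ℝ (Euc d))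
    (hL : IsFl z L) (hN : IsFl z N) (hne : N ≠ L) (hT : ∀ M, M ∈ T ↔ IsFl z M ∧ M ≤ N) :
    ∑ M ∈ T, vmob z L M = 0 := by
  classical
  simp only [vmob]
  rw [Finset.sum_comm]
  have h1 : ∀ B : Finset ι, ∑ M ∈ T, (-1 : ℝ) ^ B.card *
      (if L ⊔ Submodule.span ℝ (z '' (B : Set ι)) = M then 1 else 0) =
      (-1 : ℝ) ^ B.card * (if L ⊔ Submodule.span ℝ (z '' (B : Set ι)) ≤ N then 1 else 0) := by
    intro B
    rw [← Finset.mul_sum, Finset.sum_ite_eq]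
    simp only [hT, isFl_sup z hL (B : Set ι), true_and]
  rw [Finset.sum_congr rfl fun B _ => h1 B]
  by_cases hLN : L ≤ N
  · have h2 : ∑ B ∈ (dset z L ⊤).powerset, (-1 : ℝ) ^ B.card *
        (if L ⊔ Submodule.span ℝ (z '' (B : Set ι)) ≤ N then 1 else 0) =
        ∑ B ∈ (dset z L N).powerset, (-1 : ℝ) ^ B.card := by
      simp only [mul_ite, mul_one, mul_zero]
      rw [← Finset.sum_filter]
      refine Finset.sum_congr ?_ fun _ _ => rfl
      ext B
      simp only [Finset.mem_filter, Finset.mem_powerset]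
      constructor
      · rintro ⟨h3, h4⟩ i hi
        rw [mem_dset]
        exact ⟨h4 (Submodule.mem_sup_right (Submodule.subset_span ⟨i, hi, rfl⟩)),
          ((mem_dset z L ⊤ i).1 (h3 hi)).2⟩
      · intro h3
        refine ⟨fun i hi => (mem_dset _ _ _ _).2 ⟨trivial, ((mem_dset _ _ _ _).1 (h3 hi)).2⟩,
          sup_le hLN (Submodule.span_le.2 ?_)⟩
        rintro _ ⟨i, hi, rfl⟩
        exact ((mem_dset _ _ _ _).1 (h3 hi)).1
    rw [h2]
    have hA : (dset z L N).Nonempty := by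
      by_contra hemp
      rw [Finset.not_nonempty_iff_eq_empty] at hemp
      apply hne
      refine le_antisymm ?_ hLN
      rw [hN, Submodule.span_le]
      rintro _ ⟨i, hi, rfl⟩
      by_contra hh
      have : i ∈ dset z L N := (mem_dset _ _ _ _).2 ⟨hi, hh⟩
      rw [hemp] at this
      simp at this
    have := Finset.sum_powerset_neg_one_pow_card_of_nonempty hA
    exact_mod_cast this
  · refine Finset.sum_eq_zero fun B _ => ?_
    rw [if_neg, mul_zero]
    exact fun h => hLN (le_sup_left.trans h)

lemma mob_eq_vmob (t : Euc d) (z : ι → Euc d) (N L : ↥(Flats (zface t z 0))) :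
    mob (OrderDual.toDual N) (OrderDual.toDual L) = vmob z L.1 N.1 := by
  classical
  have hfin : (Flats (zface t z 0)).Finite :=
    (finite_isFl z).subset fun L hL => (mem_Flats_iff t z L).1 hL
  have := hfin.to_subtype
  have := Fintype.ofFinite ↥(Flats (zface t z 0))
  induction N using WellFoundedLT.induction with
  | ind N ih =>
  by_cases hNL : N = L
  · subst hNL; rw [mob_self, vmob_self]
  · have hne : OrderDual.toDual N ≠ OrderDual.toDual L := fun h => hNL (OrderDual.toDual.injective h)
    rw [mob_rec hne, neg_eq_iff_add_eq_zero]
    have h1 : ∑ b ∈ Finset.univ.filter (OrderDual.toDual N < ·), mob b (OrderDual.toDual L) =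
        ∑ M ∈ Finset.univ.filter (fun M : ↥(Flats (zface t z 0)) => M < N), vmob z L.1 M.1 := by
      refine Finset.sum_bij (fun b _ => OrderDual.ofDual b) ?_ ?_ ?_ ?_
      · intro b hb
        exact Finset.mem_filter.2 ⟨Finset.mem_univ _, (Finset.mem_filter.1 hb).2⟩
      · intro a _ b _ h
        exact OrderDual.ofDual.injective h
      · intro M hM
        exact ⟨OrderDual.toDual M, by simpa using hM, rfl⟩
      · intro b hb
        have : OrderDual.ofDual b < N := (Finset.mem_filter.1 hb).2
        rw [← ih _ this]; rfl
    rw [h1]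
    have h2 := vmob_sum z ((Finset.univ.filter (fun M : ↥(Flats (zface t z 0)) => M ≤ N)).map
      (Function.Embedding.subtype _)) L.1 N.1 ((mem_Flats_iff t z _).1 L.2)
      ((mem_Flats_iff t z _).1 N.2) (fun h => hNL (Subtype.ext h)) (by
        intro M
        simp only [Finset.mem_map, Finset.mem_filter, Finset.mem_univ, true_and]
        constructor
        · rintro ⟨M, hM, rfl⟩
          exact ⟨(mem_Flats_iff t z _).1 M.2, hM⟩
        · rintro ⟨h1, h2⟩
          exact ⟨⟨M, (mem_Flats_iff t z _).2 h1⟩, h2, rfl⟩)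
    rw [Finset.sum_map] at h2
    have h3 : Finset.univ.filter (fun M : ↥(Flats (zface t z 0)) => M ≤ N) =
        insert N (Finset.univ.filter (fun M : ↥(Flats (zface t z 0)) => M < N)) := by
      ext M
      simp [le_iff_eq_or_lt]
    rw [h3, Finset.sum_insert (by simp)] at h2
    simp only [Function.Embedding.subtype_apply] at h2
    rw [add_comm]; exact h2

end GramAngles

set_option linter.unusedSectionVars false
namespace GramAngles
variable {d : ℕ} {ι : Type*} [Fintype ι] [DecidableEq ι]

/-- Flag product along a list with a fixed top element. -/
def fprod {γ : Type*} (w : γ → γ → ℝ) (top : γ) (l : List γ) : ℝ :=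
  (List.zipWith w l (l.drop 1 ++ [top])).prod

lemma fprod_nil {γ : Type*} (w : γ → γ → ℝ) (top : γ) : fprod w top [] = 1 := by
  simp [fprod]

lemma fprod_cons {γ : Type*} (w : γ → γ → ℝ) (top x : γ) (l : List γ) :
    fprod w top (x :: l) = w x (l.headD top) * fprod w top l := by
  cases l <;> simp [fprod]

lemma faces_finite (t : Euc d) (z : ι → Euc d) :
    {F | IsFace (zface t z 0) F ∧ F.Nonempty}.Finite := by
  refine (Set.finite_range fun σ : ι → SignType => zface t z σ).subset ?_
  intro F hF
  obtain ⟨c, rfl⟩ := (face_iff _ _ _).1 hF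
  exact ⟨_, rfl⟩

/-- Face chains above a given chain of flats. -/
def Ch (Z : Set (Euc d)) (m : List ↥(Flats Z)) : Set (List (Set (Euc d))) :=
  {l | (∀ F ∈ l, IsFace Z F ∧ F.Nonempty) ∧ l.IsChain (· ⊂ ·) ∧
    l.map (fun F => vectorSpan ℝ F) = m.map Subtype.val}

lemma Ch_nil (Z : Set (Euc d)) : Ch Z [] = {[]} := by
  ext l
  simp only [Ch, Set.mem_ofPred_eq, Set.mem_singleton_iff, List.map_nil, List.map_eq_nil_iff]
  constructor
  · exact fun h => h.2.2
  · rintro rfl; simp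

lemma Ch_headD {Z : Set (Euc d)} {m : List ↥(Flats Z)} {r : List (Set (Euc d))} (h : r ∈ Ch Z m)
    (top : ↥(Flats Z)) (htop : top.1 = vectorSpan ℝ Z) :
    vectorSpan ℝ (r.headD Z) = (m.headD top).1 := by
  have h3 := h.2.2
  cases r <;> cases m <;> simp at h3 ⊢
  · exact htop.symm
  · exact h3.1

lemma face_self (t : Euc d) (z : ι → Euc d) :
    IsFace (zface t z 0) (zface t z 0) ∧ (zface t z 0).Nonempty := by
  refine (face_iff _ _ _).2 ⟨0, ?_⟩
  congr 1
  funext i; simp [cov]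

lemma Ch_face {t : Euc d} {z : ι → Euc d} {m : List ↥(Flats (zface t z 0))} {r : List (Set (Euc d))}
    (h : r ∈ Ch (zface t z 0) m) :
    IsFace (zface t z 0) (r.headD (zface t z 0)) ∧ (r.headD (zface t z 0)).Nonempty := by
  cases r with
  | nil => exact face_self t z
  | cons F r => exact h.1 F (by simp)

lemma face_sub {t : Euc d} {z : ι → Euc d} {F : Set (Euc d)}
    (h : IsFace (zface t z 0) F ∧ F.Nonempty) : F ⊆ zface t z 0 := by
  obtain ⟨c, rfl⟩ := (face_iff _ _ _).1 h
  exact zface_sub_zero _ _ _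

lemma Ch_cons (t : Euc d) (z : ι → Euc d) (L : ↥(Flats (zface t z 0)))
    (m : List ↥(Flats (zface t z 0))) (hm : (L :: m).IsChain (· < ·)) :
    Ch (zface t z 0) (L :: m) = ⋃ r ∈ Ch (zface t z 0) m,
      (fun F => F :: r) '' facesUnder (zface t z 0) (r.headD (zface t z 0)) L.1 := by
  ext l
  simp only [Set.mem_iUnion, Set.mem_image, exists_prop]
  constructor
  · rintro ⟨h1, h2, h3⟩
    rcases l with _ | ⟨F, r⟩
    · simp at h3
    · simp only [List.map_cons, List.cons.injEq] at h3
      refine ⟨r, ⟨fun G hG => h1 G (List.mem_cons_of_mem _ hG), ?_, h3.2⟩, F,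
        ⟨h1 F (by simp), ?_, h3.1⟩, rfl⟩
      · exact h2.tail
      · cases r with
        | nil => exact face_sub (h1 F (by simp))
        | cons G r => exact (List.isChain_cons_cons.1 h2).1.subset
  · rintro ⟨r, ⟨h1, h2, h3⟩, F, ⟨hF, hFr, hFL⟩, rfl⟩
    refine ⟨?_, ?_, ?_⟩
    · intro G hG
      rcases List.mem_cons.1 hG with rfl | hG
      · exact hF
      · exact h1 G hG
    · cases r with
      | nil => exact List.isChain_singleton _
      | cons G r =>
        refine List.isChain_cons_cons.2 ⟨?_, h2⟩
        refine Set.ssubset_iff_subset_ne.2 ⟨hFr, ?_⟩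
        rintro rfl
        cases m with
        | nil => simp at h3
        | cons M m =>
          simp only [List.map_cons, List.cons.injEq] at h3
          have h4 : L < M := (List.isChain_cons_cons.1 hm).1
          have h5 : L.1 = M.1 := hFL.symm.trans h3.1
          exact h4.ne (Subtype.ext h5)
    · simp only [List.map_cons, hFL, h3]

lemma Ch_sum (t : Euc d) (z : ι → Euc d) (top : ↥(Flats (zface t z 0)))
    (htop : top.1 = vectorSpan ℝ (zface t z 0))
    (w : Set (Euc d) → Set (Euc d) → ℝ) (u : ↥(Flats (zface t z 0)) → ↥(Flats (zface t z 0)) → ℝ)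
    (H : ∀ G, (IsFace (zface t z 0) G ∧ G.Nonempty) → ∀ L N : ↥(Flats (zface t z 0)),
      N.1 = vectorSpan ℝ G → L ≤ N → ∑ᶠ F ∈ facesUnder (zface t z 0) G L.1, w F G = u L N)
    (m : List ↥(Flats (zface t z 0))) (hm : m.IsChain (· < ·)) :
    (Ch (zface t z 0) m).Finite ∧
    ∑ᶠ l ∈ Ch (zface t z 0) m, fprod w (zface t z 0) l = fprod u top m := by
  have hle : ∀ L : ↥(Flats (zface t z 0)), L ≤ top := by
    rintro ⟨L, F, h1, h2, rfl⟩
    change vectorSpan ℝ F ≤ top.1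
    rw [htop]
    exact vectorSpan_mono ℝ (face_sub ⟨h1, h2⟩)
  induction m with
  | nil =>
    rw [Ch_nil]
    exact ⟨Set.finite_singleton _, by rw [finsum_mem_singleton, fprod_nil, fprod_nil]⟩
  | cons L m ih =>
    obtain ⟨ih1, ih2⟩ := ih hm.tail
    have hfu : ∀ G, (facesUnder (zface t z 0) G L.1).Finite := fun G =>
      (faces_finite t z).subset fun F hF => hF.1
    rw [Ch_cons t z L m hm]
    refine ⟨ih1.biUnion fun r _ => (hfu _).image _, ?_⟩
    rw [finsum_mem_biUnion _ ih1 fun r _ => (hfu _).image _]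
    · rw [fprod_cons, ← ih2, ← smul_eq_mul, smul_finsum_mem ih1]
      refine finsum_mem_congr rfl fun r hr => ?_
      rw [finsum_mem_image (by intro a _ b _ h; simpa using h)]
      have hlast : L ≤ m.headD top := by
        cases m with
        | nil => exact hle L
        | cons M m => exact (List.isChain_cons_cons.1 hm).1.le
      rw [← H (r.headD (zface t z 0)) (Ch_face hr) L _ (Ch_headD hr top htop).symm hlast]
      rw [smul_eq_mul, finsum_mem_mul' _ _ (hfu _)]
      refine finsum_mem_congr rfl fun F _ => ?_
      rw [fprod_cons]
    · intro r _ r' _ hrr'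
      rw [Function.onFun, Set.disjoint_left]
      rintro _ ⟨F, _, rfl⟩ ⟨F', _, h⟩
      simp at h
      exact hrr' h.2.symm

/-- Chains of flats with prescribed ranks. -/
def flatCh (Z : Set (Euc d)) (S : Finset ℕ) : Set (List ↥(Flats Z)) :=
  {m | m.IsChain (· < ·) ∧ m.map (fun L => Module.finrank ℝ L.1) = S.sort (· ≤ ·)}

lemma faceChains_eq (Z : Set (Euc d)) (S : Finset ℕ) :
    faceChains Z S = ⋃ m ∈ flatCh Z S, Ch Z m := by
  ext l
  simp only [Set.mem_iUnion, exists_prop]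
  constructor
  · rintro ⟨h1, h2, h3⟩
    have hmem : ∀ F ∈ l, vectorSpan ℝ F ∈ Flats Z := fun F hF => ⟨F, (h1 F hF).1, (h1 F hF).2, rfl⟩
    have hval : (l.pmap (fun F hF => (⟨vectorSpan ℝ F, hF⟩ : ↥(Flats Z))) hmem).map Subtype.val =
        l.map (fun F => vectorSpan ℝ F) := by
      rw [List.map_pmap, List.pmap_eq_map]
    refine ⟨l.pmap (fun F hF => (⟨vectorSpan ℝ F, hF⟩ : ↥(Flats Z))) hmem, ⟨?_, ?_⟩, h1, h2, hval.symm⟩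
    · have h4 : (l.map sdim).Pairwise (· < ·) := by
        rw [h3]; exact (Finset.sortedLT_sort S).pairwise
      rw [List.pairwise_map] at h4
      have h5 : l.Pairwise (· ⊂ ·) := List.isChain_iff_pairwise.1 h2
      rw [List.isChain_iff_pairwise, List.pairwise_pmap]
      refine (h4.and h5).imp ?_
      rintro F G ⟨ha, hb⟩ hF hG
      refine lt_of_le_of_ne (vectorSpan_mono ℝ hb.subset : vectorSpan ℝ F ≤ vectorSpan ℝ G) ?_
      intro h
      have : vectorSpan ℝ F = vectorSpan ℝ G := congrArg Subtype.val h
      rw [sdim, sdim, this] at ha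
      exact lt_irrefl _ ha
    · rw [← h3, List.map_pmap]
      exact List.pmap_eq_map (f := sdim) hmem
  · rintro ⟨m, ⟨h1, h2⟩, h3, h4, h5⟩
    refine ⟨h3, h4, ?_⟩
    have : l.map sdim = (l.map (fun F => vectorSpan ℝ F)).map (fun L : Submodule ℝ (Euc d) => Module.finrank ℝ L) := by
      rw [List.map_map]; rfl
    rw [this, h5, List.map_map, ← h2]; rfl

lemma flag_sum (t : Euc d) (z : ι → Euc d) (top : ↥(Flats (zface t z 0)))
    (htop : top.1 = vectorSpan ℝ (zface t z 0))
    (w : Set (Euc d) → Set (Euc d) → ℝ) (u : ↥(Flats (zface t z 0)) → ↥(Flats (zface t z 0)) → ℝ)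
    (H : ∀ G, (IsFace (zface t z 0) G ∧ G.Nonempty) → ∀ L N : ↥(Flats (zface t z 0)),
      N.1 = vectorSpan ℝ G → L ≤ N → ∑ᶠ F ∈ facesUnder (zface t z 0) G L.1, w F G = u L N)
    (S : Finset ℕ) :
    ∑ᶠ l ∈ faceChains (zface t z 0) S, fprod w (zface t z 0) l =
      ∑ᶠ m ∈ flatCh (zface t z 0) S, fprod u top m := by
  have hfin : (Flats (zface t z 0)).Finite :=
    (finite_isFl z).subset fun L hL => (mem_Flats_iff t z L).1 hL
  have := hfin.to_subtype
  rw [faceChains_eq, finsum_mem_biUnion]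
  · exact finsum_mem_congr rfl fun m hm => (Ch_sum t z top htop w u H m hm.1).2
  · intro m _ m' _ hmm'
    rw [Function.onFun, Set.disjoint_left]
    rintro l h1 h2
    apply hmm'
    have := h1.2.2.symm.trans h2.2.2
    exact List.map_injective_iff.2 Subtype.val_injective this
  · exact chains_finite.subset fun m hm => hm.1
  · exact fun m hm => (Ch_sum t z top htop w u H m hm.1).1

end GramAngles

set_option linter.unusedSectionVars false
namespace GramAngles
variable {d : ℕ} {ι : Type*} [Fintype ι] [DecidableEq ι]

lemma zipWith_snoc {γ : Type*} (f : γ → γ → ℝ) (b x : γ) (l : List γ) :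
    (List.zipWith f (b :: (l ++ [x])) (l ++ [x])).prod =
      (List.zipWith f (b :: l) l).prod * f (l.getLastD b) x := by
  induction l generalizing b with
  | nil => simp
  | cons y l ih =>
    have := ih y
    simp only [List.cons_append, List.zipWith_cons_cons, List.prod_cons, List.getLastD_cons] at this ⊢
    rw [this, mul_assoc]

lemma zipWith_rev {γ : Type*} (f : γ → γ → ℝ) (top : γ) (m : List γ) :
    (List.zipWith f (top :: m.reverse) m.reverse).prod = fprod (fun a b => f b a) top m := by
  induction m with
  | nil => simp [fprod]
  | cons x m ih =>
    rw [List.reverse_cons, zipWith_snoc, ih, fprod_cons, mul_comm]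
    congr 2
    cases m <;> simp

lemma sort_image_sub (d : ℕ) (S : Finset ℕ) (hS : ∀ s ∈ S, s ≤ d) :
    (S.image (fun s => d - s)).sort (· ≤ ·) = ((S.sort (· ≤ ·)).map (fun s => d - s)).reverse := by
  have hp : (((S.sort (· ≤ ·)).map (fun s => d - s)).reverse).Pairwise (· < ·) := by
    rw [List.pairwise_reverse, List.pairwise_map]
    refine List.Pairwise.imp_of_mem ?_ (Finset.sortedLT_sort S).pairwise
    intro a b ha hb hab
    rw [Finset.mem_sort] at ha hb
    have := hS a ha
    have := hS b hb
    omega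
  have h1 : (S.image (fun s => d - s)) = (((S.sort (· ≤ ·)).map (fun s => d - s)).reverse).toFinset := by
    ext x
    simp
  rw [h1]
  exact (List.toFinset_sort (· ≤ ·) (hp.imp fun h => ne_of_lt h)).2 (hp.imp fun h => le_of_lt h)

lemma sign_tele {Z : Set (Euc d)} (top : ↥(Flats Z)) (hle : ∀ L : ↥(Flats Z), L ≤ top)
    (v : ↥(Flats Z) → ↥(Flats Z) → ℝ) (m : List ↥(Flats Z)) (hm : m.IsChain (· < ·)) :
    fprod (fun L N => (-1 : ℝ) ^ (Module.finrank ℝ N.1 - Module.finrank ℝ L.1) * v L N) top m =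
      (-1 : ℝ) ^ (Module.finrank ℝ top.1 - Module.finrank ℝ (m.headD top).1) * fprod v top m := by
  induction m with
  | nil =>
    have h0 : ∀ a : ℕ, (1 : ℝ) = (-1 : ℝ) ^ (a - a) * 1 := by
      intro a; rw [Nat.sub_self, pow_zero, one_mul]
    exact h0 _
  | cons L m ih =>
    rw [fprod_cons, fprod_cons, ih hm.tail]
    have h1 : L ≤ m.headD top := by
      cases m with
      | nil => exact hle L
      | cons M m => exact (List.isChain_cons_cons.1 hm).1.le
    have h2 : Module.finrank ℝ L.1 ≤ Module.finrank ℝ (m.headD top).1 := Submodule.finrank_mono h1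
    have h3 : Module.finrank ℝ (m.headD top).1 ≤ Module.finrank ℝ top.1 :=
      Submodule.finrank_mono (hle _)
    have h4 : Module.finrank ℝ top.1 - Module.finrank ℝ ((L :: m).headD top).1 =
        (Module.finrank ℝ (m.headD top).1 - Module.finrank ℝ L.1) +
        (Module.finrank ℝ top.1 - Module.finrank ℝ (m.headD top).1) := by
      have tele : ∀ a b c : ℕ, a ≤ b → b ≤ c → c - a = (b - a) + (c - b) := by
        intro a b c h h'; omega
      exact tele _ _ _ h2 h3
    rw [h4, pow_add]
    ring

lemma head_sort (S : Finset ℕ) (hS : S.Nonempty) (x : ℕ) (l : List ℕ)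
    (h : x :: l = S.sort (· ≤ ·)) : x = S.min' hS := by
  have hmem : ∀ y, y ∈ S ↔ y ∈ x :: l := fun y => by rw [h, Finset.mem_sort]
  have hp : (x :: l).Pairwise (· ≤ ·) := by rw [h]; exact Finset.pairwise_sort S _
  apply le_antisymm
  · refine Finset.le_min' _ _ _ fun y hy => ?_
    rcases List.mem_cons.1 ((hmem y).1 hy) with rfl | hy
    · exact le_rfl
    · exact List.rel_of_pairwise_cons hp hy
  · exact Finset.min'_le _ _ ((hmem x).2 (by simp))

lemma flag_bij (Z : Set (Euc d)) (S : Finset ℕ) (hS : ∀ s ∈ S, s ≤ d) :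
    Set.BijOn (fun m : List ↥(Flats Z) => (m.map OrderDual.toDual).reverse) (flatCh Z S)
      {l : List (↥(Flats Z))ᵒᵈ | l.IsChain (· < ·) ∧
        l.map (fun L => d - Module.finrank ℝ (OrderDual.ofDual L).1) =
          (S.image (fun s => d - s)).sort (· ≤ ·)} := by
  have hfr : ∀ L : ↥(Flats Z), Module.finrank ℝ L.1 ≤ d := fun L => by
    have := Submodule.finrank_le L.1
    rwa [finrank_euclideanSpace, Fintype.card_fin] at this
  refine ⟨?_, ?_, ?_⟩
  · rintro m ⟨h1, h2⟩
    refine ⟨?_, ?_⟩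
    · rw [List.isChain_reverse, List.isChain_map]
      exact h1
    · rw [sort_image_sub d S hS, ← h2, List.map_reverse, List.map_map, List.map_map]
      rfl
  · intro m _ m' _ h
    have := List.reverse_injective h
    exact List.map_injective_iff.2 OrderDual.toDual.injective this
  · rintro l ⟨h1, h2⟩
    refine ⟨l.reverse.map OrderDual.ofDual, ⟨?_, ?_⟩, ?_⟩
    · rw [List.isChain_map, List.isChain_reverse]
      exact h1
    · rw [sort_image_sub d S hS] at h2
      have h3 := congrArg (fun k => (k.map (fun s => d - s)).reverse) h2
      simp only [List.map_reverse, List.reverse_reverse, List.map_map] at h3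
      have h4 : (S.sort (· ≤ ·)).map ((fun s => d - s) ∘ fun s => d - s) = S.sort (· ≤ ·) := by
        conv_rhs => rw [← List.map_id (S.sort (· ≤ ·))]
        refine List.map_congr_left fun s hs => ?_
        have := hS s ((Finset.mem_sort _).1 hs)
        simp only [Function.comp, id]
        omega
      rw [h4] at h3
      rw [← h3, List.map_map, List.map_reverse]
      congr 1
      refine List.map_congr_left fun L _ => ?_
      have := hfr (OrderDual.ofDual L)
      simp only [Function.comp]
      omega
    · simp only [List.map_map, List.map_reverse, List.reverse_reverse]
      exact List.map_id l

theorem main_aux (α : ConeAngle d) (t : Euc d) (z : ι → Euc d)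
    (hdim : sdim (zface t z 0) = d)
    (top : ↥(Flats (zface t z 0))) (htop : top.1 = vectorSpan ℝ (zface t z 0))
    (S : Finset ℕ) (hS : S.Nonempty) (hSd : ∀ s ∈ S, s ≤ d) :
    extFlag α (zface t z 0) S =
      (flagW2 (fun L : ↥(Flats (zface t z 0)) => Module.finrank ℝ L.1) S : ℝ) ∧
    intFlag α (zface t z 0) S = (-1) ^ (d - S.min' hS) *
      flagW1 (β := (↥(Flats (zface t z 0)))ᵒᵈ)
        (fun L => d - Module.finrank ℝ (OrderDual.ofDual L).1)
        (OrderDual.toDual top) (S.image (fun s => d - s)) := by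
  have hfin : (Flats (zface t z 0)).Finite :=
    (finite_isFl z).subset fun L hL => (mem_Flats_iff t z L).1 hL
  have := hfin.to_subtype
  have hle : ∀ L : ↥(Flats (zface t z 0)), L ≤ top := by
    rintro ⟨L, F, h1, h2, rfl⟩
    change vectorSpan ℝ F ≤ top.1
    rw [htop]
    exact vectorSpan_mono ℝ (face_sub ⟨h1, h2⟩)
  have hfinS : (flatCh (zface t z 0) S).Finite := chains_finite.subset fun m hm => hm.1
  constructor
  · have h1 := flag_sum t z top htop (extAngle α) (fun _ _ => 1) (by
      intro G hG L N hN hLN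
      obtain ⟨c, rfl⟩ := (face_iff _ _ _).1 hG
      rw [vectorSpan_zface] at hN
      exact ext_sum α t z c L.1 ((mem_Flats_iff t z _).1 L.2) N.1 hN hLN) S
    have h2 : ∀ m : List ↥(Flats (zface t z 0)), fprod (fun _ _ => (1 : ℝ)) top m = 1 := by
      intro m
      induction m with
      | nil => exact fprod_nil _ _
      | cons L m ih => rw [fprod_cons, ih, one_mul]
    simp only [h2] at h1
    refine h1.trans ?_
    rw [finsum_mem_eq_finite_toFinset_sum _ hfinS, Finset.sum_const, nsmul_eq_mul, mul_one,
      ← Set.ncard_eq_toFinset_card _ hfinS]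
    rfl
  · have h1 := flag_sum t z top htop (intAngle α)
      (fun L N => (-1 : ℝ) ^ (Module.finrank ℝ N.1 - Module.finrank ℝ L.1) *
        mob (OrderDual.toDual N) (OrderDual.toDual L)) (by
      intro G hG L N hN hLN
      obtain ⟨c, rfl⟩ := (face_iff _ _ _).1 hG
      rw [vectorSpan_zface] at hN
      rw [mob_eq_vmob]
      exact int_sum α t z c L.1 ((mem_Flats_iff t z _).1 L.2) N.1 hN hLN) S
    refine h1.trans ?_
    rw [flagW1, mul_finsum_mem]
    refine finsum_mem_eq_of_bijOn _ (flag_bij (zface t z 0) S hSd) ?_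
    rintro m ⟨hm1, hm2⟩
    rw [sign_tele top hle (fun L N => mob (OrderDual.toDual N) (OrderDual.toDual L)) m hm1, zipWith_rev]
    have h3 : Module.finrank ℝ top.1 = d := by rw [htop]; exact hdim
    have h4 : Module.finrank ℝ (m.headD top).1 = S.min' hS := by
      cases m with
      | nil =>
        exfalso
        have : S.sort (· ≤ ·) = [] := hm2.symm
        obtain ⟨s, hs⟩ := hS
        rw [← Finset.mem_sort (· ≤ ·), this] at hs
        simp at hs
      | cons L m => exact head_sort S hS _ _ hm2
    rw [h3, h4]
    congr 1
    clear h1 h4 hm1 hm2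
    induction m with
    | nil => rfl
    | cons L m ih =>
      rw [List.map_cons, fprod_cons, fprod_cons, ih]
      congr 1
      cases m <;> rfl

end GramAngles

namespace GramAngles

/-- Theorem 1.4: flag-angle vectors of zonotopes.
For a cone angle `α`, a full-dimensional zonotope `Z ⊂ ℝ^d` with lattice of flats
`L(Z)` and nonempty `S ⊆ {0,…,d-1}` with `r = min S`:
`α̌_S(Z) = W_S(L(Z))` and `α̂_S(Z) = (-1)^{d-r} w_{d-S}(L(Z)^op)`. -/
theorem statement16 (d : ℕ) (hd : 0 < d) (α : ConeAngle d) (Z : Set (Euc d))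
    (hZ : IsZonotope Z) (hdim : sdim Z = d)
    (top : ↥(Flats Z)) (htop : top.1 = vectorSpan ℝ Z)
    (S : Finset ℕ) (hS : S.Nonempty) (hSd : ∀ s ∈ S, s ≤ d - 1) :
    extFlag α Z S = (flagW2 (fun L : ↥(Flats Z) => Module.finrank ℝ L.1) S : ℝ) ∧
    intFlag α Z S = (-1) ^ (d - S.min' hS) *
      flagW1 (β := (↥(Flats Z))ᵒᵈ)
        (fun L => d - Module.finrank ℝ (OrderDual.ofDual L).1)
        (OrderDual.toDual top) (S.image (fun s => d - s)) := by
  obtain ⟨t, n, z, hZe⟩ := hZ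
  have hZ0 : Z = zface t z 0 := by
    rw [hZe]; ext x; simp [zface]
  clear hZe
  subst hZ0
  exact main_aux α t z hdim top htop S hS (fun s hs => (hSd s hs).trans (Nat.sub_le d 1))

end GramAngles
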